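/- Let n ≥ 2, λ ≥ 1, N > 0, and M > 0 with M sufficiently large (depending on n, λ). There exist a natural number T and a constant C > 0, depending only on λ, n, N, M, such that the following holds. Let A be a C¹ map from B(0,M) ⊂ ℝⁿ to n×n real matrices, uniformly elliptic with constant λ, with every entry of A Lipschitz with Lipschitz constant at most λ, and with A(0) = I. Let u be a nonzero solution of div(A∇u) = 0 on B(0,M) whose frequency function satisfies β_u(0,r) ≤ N for all 0 < r < M. Then ∫_{B(0,1/4)} |u|² dx ≤ C · Σ_{m=0}^{T} ‖P_m(u|_{∂B(0,1)})‖²_{L²(∂B(0,1))}, where P_m denotes the orthogonal projection of L²(∂B(0,1)) (with the surface measure ℋ^{n-1}) onto the finite-dimensional subspace consisting of restrictions to ∂B(0,1) of homogeneous harmonic polynomials of degree m. -/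

import Mathlib

open MeasureTheory Metric

noncomputable section

/-- Partial derivative in the `i`-th coordinate direction. -/
def pd {n : ℕ} (i : Fin n) (u : EuclideanSpace ℝ (Fin n) → ℝ) :
    EuclideanSpace ℝ (Fin n) → ℝ :=
  fun x => fderiv ℝ u x (EuclideanSpace.single i 1)

/-- `A` is uniformly elliptic with constant `lam` on the set `s`. -/
def UnifElliptic {n : ℕ} (A : EuclideanSpace ℝ (Fin n) → Matrix (Fin n) (Fin n) ℝ)
    (lam : ℝ) (s : Set (EuclideanSpace ℝ (Fin n))) : Prop :=
  ∀ x ∈ s, ∀ ξ : Fin n → ℝ,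
    lam⁻¹ * (∑ i, ξ i ^ 2) ≤ ∑ i, ∑ j, A x i j * ξ i * ξ j ∧
    ∑ i, ∑ j, A x i j * ξ i * ξ j ≤ lam * (∑ i, ξ i ^ 2)

/-- `u` solves `div(A ∇ u) = 0` on `s`, i.e. `Σ_{i,j} ∂_i (A_{ij} ∂_j u) = 0` on `s`. -/
def SolvesDiv {n : ℕ} (A : EuclideanSpace ℝ (Fin n) → Matrix (Fin n) (Fin n) ℝ)
    (u : EuclideanSpace ℝ (Fin n) → ℝ) (s : Set (EuclideanSpace ℝ (Fin n))) : Prop :=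
  ∀ x ∈ s, ∑ i, ∑ j, pd i (fun y => A y i j * pd j u y) x = 0

/-- Almgren-type frequency function `β_u(0,r) = r·D(r)/h(r)` for `div(A ∇ u) = 0`
(assuming `A 0 = I`), where `D(r) = r^{1-n} ∫_{B(0,r)} ⟨A∇u,∇u⟩` and
`h(r) = r^{1-n} ∫_{∂B(0,r)} μ u²` with `μ(x) = ⟨A(x)x,x⟩/|x|²`. -/
def freq {n : ℕ} (A : EuclideanSpace ℝ (Fin n) → Matrix (Fin n) (Fin n) ℝ)
    (u : EuclideanSpace ℝ (Fin n) → ℝ) (r : ℝ) : ℝ :=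
  r * (r ^ (1 - (n : ℝ)) * ∫ x in closedBall (0 : EuclideanSpace ℝ (Fin n)) r,
        ∑ i, ∑ j, A x i j * pd j u x * pd i u x) /
    (r ^ (1 - (n : ℝ)) * ∫ x in sphere (0 : EuclideanSpace ℝ (Fin n)) r,
        ((∑ i, ∑ j, A x i j * x j * x i) / ‖x‖ ^ 2) * u x ^ 2 ∂ μH[(n : ℝ) - 1])

/-- `p` is the evaluation of a homogeneous harmonic polynomial of degree `m`. -/
def IsHHP {n : ℕ} (m : ℕ) (p : EuclideanSpace ℝ (Fin n) → ℝ) : Prop :=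
  ∃ q : MvPolynomial (Fin n) ℝ, q.IsHomogeneous m ∧
    (∀ x : EuclideanSpace ℝ (Fin n), p x = MvPolynomial.eval (fun i => x i) q) ∧
    ∀ x : EuclideanSpace ℝ (Fin n), ∑ i, pd i (pd i p) x = 0

open MvPolynomial in
/-- The formal Laplacian of a polynomial. -/
def polyLap {n : ℕ} (q : MvPolynomial (Fin n) ℝ) : MvPolynomial (Fin n) ℝ :=
  ∑ i, pderiv i (pderiv i q)

open MvPolynomial in
/-- The polynomial `∑ Xᵢ²`. -/
def polyNormSq (n : ℕ) : MvPolynomial (Fin n) ℝ := ∑ i, X i ^ 2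

section Polynomial

open MvPolynomial

variable {n : ℕ}

lemma polyLap_sub (p q : MvPolynomial (Fin n) ℝ) : polyLap (p - q) = polyLap p - polyLap q := by
  simp [polyLap, Finset.sum_sub_distrib]

lemma polyLap_C_mul (c : ℝ) (p : MvPolynomial (Fin n) ℝ) :
    polyLap (C c * p) = C c * polyLap p := by
  simp [polyLap, Finset.mul_sum]

lemma polyNormSq_isHomogeneous : (polyNormSq n).IsHomogeneous 2 :=
  IsHomogeneous.sum _ _ _ fun i _ => by simpa using (isHomogeneous_X ℝ i).pow 2

lemma polyLap_isHomogeneous {q : MvPolynomial (Fin n) ℝ} {d : ℕ} (hq : q.IsHomogeneous d) :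
    (polyLap q).IsHomogeneous (d - 2) :=
  IsHomogeneous.sum _ _ _ fun i _ => by
    simpa [Nat.sub_sub] using (hq.pderiv (i := i)).pderiv (i := i)

lemma pderiv_polyNormSq (i : Fin n) : pderiv i (polyNormSq n) = 2 * X i := by
  classical
  simp [polyNormSq, pderiv_X, Pi.single_apply]

lemma polyLap_polyNormSq_mul {q : MvPolynomial (Fin n) ℝ} {d : ℕ} (hq : q.IsHomogeneous d) :
    polyLap (polyNormSq n * q) = polyNormSq n * polyLap q + C (2 * n + 4 * d : ℝ) * q := by
  have key : ∀ i, pderiv i (pderiv i (polyNormSq n * q)) =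
      polyNormSq n * pderiv i (pderiv i q) + (4 * (X i * pderiv i q) + 2 * q) := by
    intro i
    have h2 : pderiv i (2 : MvPolynomial (Fin n) ℝ) = 0 := by
      exact_mod_cast (pderiv i).map_natCast 2
    simp [pderiv_polyNormSq, h2]
    ring
  have euler := hq.sum_X_mul_pderiv
  simp only [polyLap, key, Finset.sum_add_distrib, ← Finset.mul_sum, euler]
  have h2 : (C 2 : MvPolynomial (Fin n) ℝ) = 2 := map_ofNat C 2
  have h4 : (C 4 : MvPolynomial (Fin n) ℝ) = 4 := map_ofNat C 4
  simp [h2, h4]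
  ring

lemma polyLap_polyNormSq_pow_mul (hn : 0 < n) {q : MvPolynomial (Fin n) ℝ} {d : ℕ}
    (hq : q.IsHomogeneous d) (j : ℕ) :
    ∃ c : ℝ, 0 < c ∧ polyLap (polyNormSq n ^ (j + 1) * q) =
      polyNormSq n ^ (j + 1) * polyLap q + C c * (polyNormSq n ^ j * q) := by
  have hn' : (0 : ℝ) < n := by exact_mod_cast hn
  induction j with
  | zero => exact ⟨2 * n + 4 * d, by positivity, by simp [polyLap_polyNormSq_mul hq]⟩
  | succ j ih =>
    obtain ⟨c, hc, h⟩ := ih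
    have hh : (polyNormSq n ^ (j + 1) * q).IsHomogeneous (2 * (j + 1) + d) :=
      (polyNormSq_isHomogeneous.pow _).mul hq
    refine ⟨c + (2 * n + 4 * (2 * (j + 1) + d : ℕ)), by positivity, ?_⟩
    rw [pow_succ', mul_assoc, polyLap_polyNormSq_mul hh, h,
      map_add C c]
    ring

lemma exists_polyLap_polyNormSq_mul_eq (hn : 0 < n) (d : ℕ) :
    ∀ (g : MvPolynomial (Fin n) ℝ), g.IsHomogeneous d → ∀ j : ℕ,
      ∃ q : MvPolynomial (Fin n) ℝ, q.IsHomogeneous (2 * j + d) ∧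
        polyLap (polyNormSq n * q) = polyNormSq n ^ j * g := by
  induction d using Nat.strong_induction_on with
  | _ d ih =>
  intro g hg j
  obtain ⟨c, hc, h⟩ := polyLap_polyNormSq_pow_mul hn hg j
  have hCc : (C c⁻¹ * C c : MvPolynomial (Fin n) ℝ) = 1 := by
    rw [← C_mul, inv_mul_cancel₀ hc.ne', C_1]
  have hg' : (polyNormSq n ^ j * g).IsHomogeneous (2 * j + d) :=
    (polyNormSq_isHomogeneous.pow _).mul hg
  have hC : ∀ {p : MvPolynomial (Fin n) ℝ}, p.IsHomogeneous (2 * j + d) →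
      (C c⁻¹ * p).IsHomogeneous (2 * j + d) := fun hp => by
    simpa using (isHomogeneous_C (Fin n) c⁻¹).mul hp
  rcases lt_or_ge d 2 with hd | hd
  · have h0 : polyLap g = 0 := by
      refine Finset.sum_eq_zero fun i _ => ?_
      have h1 : (pderiv i g).IsHomogeneous 0 := by
        have := hg.pderiv (i := i)
        rwa [show d - 1 = 0 by omega] at this
      rw [← totalDegree_zero_iff_isHomogeneous, totalDegree_eq_zero_iff_eq_C] at h1
      rw [h1, pderiv_C]
    refine ⟨C c⁻¹ * (polyNormSq n ^ j * g), hC hg', ?_⟩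
    rw [mul_left_comm, polyLap_C_mul, ← mul_assoc, ← pow_succ', h, h0, mul_zero, zero_add,
      ← mul_assoc, hCc, one_mul]
  · obtain ⟨q', hq', e⟩ := ih (d - 2) (by omega) _ (polyLap_isHomogeneous hg) (j + 1)
    rw [show 2 * (j + 1) + (d - 2) = 2 * j + d by omega] at hq'
    refine ⟨C c⁻¹ * (polyNormSq n ^ j * g - q'), hC (hg'.sub hq'), ?_⟩
    rw [mul_left_comm, polyLap_C_mul, mul_sub, polyLap_sub, e, ← mul_assoc (polyNormSq n),
      ← pow_succ', h, add_sub_cancel_left, ← mul_assoc, hCc, one_mul]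

lemma exists_harmonic_add_polyNormSq_mul (hn : 0 < n) {d : ℕ} {f : MvPolynomial (Fin n) ℝ}
    (hf : f.IsHomogeneous d) :
    ∃ h g : MvPolynomial (Fin n) ℝ, h.IsHomogeneous d ∧ polyLap h = 0 ∧
      g.IsHomogeneous (d - 2) ∧ (d < 2 → g = 0) ∧ f = h + polyNormSq n * g := by
  rcases lt_or_ge d 2 with hd | hd
  · refine ⟨f, 0, hf, ?_, isHomogeneous_zero _ _ _, fun _ => rfl, by simp⟩
    refine Finset.sum_eq_zero fun i _ => ?_
    have h1 : (pderiv i f).IsHomogeneous 0 := by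
      have := hf.pderiv (i := i)
      rwa [show d - 1 = 0 by omega] at this
    rw [← totalDegree_zero_iff_isHomogeneous, totalDegree_eq_zero_iff_eq_C] at h1
    rw [h1, pderiv_C]
  · obtain ⟨g, hg, e⟩ := exists_polyLap_polyNormSq_mul_eq hn _ _ (polyLap_isHomogeneous hf) 0
    rw [show 2 * 0 + (d - 2) = d - 2 by omega] at hg
    refine ⟨f - polyNormSq n * g, g, hf.sub ?_, ?_, hg, by omega, by ring⟩
    · have := polyNormSq_isHomogeneous.mul hg
      rwa [show 2 + (d - 2) = d by omega] at this
    · rw [polyLap_sub, e]; simp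

lemma hasFDerivAt_eval (q : MvPolynomial (Fin n) ℝ) (x : EuclideanSpace ℝ (Fin n)) :
    HasFDerivAt (fun y : EuclideanSpace ℝ (Fin n) => eval (fun i => y i) q)
      (∑ i, eval (fun i => x i) (pderiv i q) • (EuclideanSpace.proj i :
        EuclideanSpace ℝ (Fin n) →L[ℝ] ℝ)) x := by
  classical
  induction q using MvPolynomial.induction_on with
  | C a => simpa using hasFDerivAt_const a x
  | add p q hp hq =>
    simp only [map_add, add_smul, Finset.sum_add_distrib]
    exact hp.add hq
  | mul_X p i hp =>
    have hX : HasFDerivAt (fun y : EuclideanSpace ℝ (Fin n) => y i)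
      (EuclideanSpace.proj i : EuclideanSpace ℝ (Fin n) →L[ℝ] ℝ) x :=
      (EuclideanSpace.proj i : EuclideanSpace ℝ (Fin n) →L[ℝ] ℝ).hasFDerivAt
    simp only [map_mul, eval_X]
    refine (hp.mul hX).congr_fderiv ?_
    simp only [pderiv_mul, pderiv_X, map_add, map_mul, eval_X, add_smul, Finset.sum_add_distrib,
      Finset.smul_sum, smul_smul]
    rw [add_comm]
    congr 1
    · exact Finset.sum_congr rfl fun j _ => by rw [mul_comm]
    · rw [Finset.sum_eq_single i]
      · simp
      · intro j _ hj
        simp [hj.symm]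
      · simp

lemma pd_eval (q : MvPolynomial (Fin n) ℝ) (i : Fin n) :
    pd i (fun y : EuclideanSpace ℝ (Fin n) => eval (fun i => y i) q) =
      fun y => eval (fun i => y i) (pderiv i q) := by
  funext x
  classical
  rw [pd, (hasFDerivAt_eval q x).fderiv]
  simp [sum_apply]

lemma contDiff_eval (q : MvPolynomial (Fin n) ℝ) {k : WithTop ℕ∞} :
    ContDiff ℝ k (fun y : EuclideanSpace ℝ (Fin n) => eval (fun i => y i) q) := by
  induction q using MvPolynomial.induction_on with
  | C a => simpa using contDiff_const
  | add p q hp hq => simpa using hp.add hq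
  | mul_X p i hp =>
    simpa using hp.mul (EuclideanSpace.proj i : EuclideanSpace ℝ (Fin n) →L[ℝ] ℝ).contDiff

lemma isHHP_eval {q : MvPolynomial (Fin n) ℝ} {m : ℕ} (hq : q.IsHomogeneous m)
    (h : polyLap q = 0) :
    IsHHP m (fun y : EuclideanSpace ℝ (Fin n) => eval (fun i => y i) q) := by
  refine ⟨q, hq, fun _ => rfl, fun x => ?_⟩
  simp only [pd_eval]
  rw [← map_sum]
  change eval _ (polyLap q) = 0
  rw [h, map_zero]

lemma isHHP_zero (m : ℕ) : IsHHP (n := n) m (fun _ => 0) := by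
  simpa using isHHP_eval (n := n) (isHomogeneous_zero (Fin n) ℝ m) (by simp [polyLap])

lemma IsHHP.add {m : ℕ} {p q : EuclideanSpace ℝ (Fin n) → ℝ} (hp : IsHHP m p) (hq : IsHHP m q) :
    IsHHP m (fun x => p x + q x) := by
  obtain ⟨P, hP, eP, lP⟩ := hp
  obtain ⟨Q, hQ, eQ, lQ⟩ := hq
  obtain rfl : p = fun x => eval (fun i => x i) P := funext eP
  obtain rfl : q = fun x => eval (fun i => x i) Q := funext eQ
  refine ⟨P + Q, hP.add hQ, fun x => by simp, fun x => ?_⟩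
  have := congrArg₂ (· + ·) (lP x) (lQ x)
  simp only [pd_eval, ← map_add] at this ⊢
  simpa [Finset.sum_add_distrib] using this

/-- A function which agrees on the unit sphere with a finite sum of homogeneous harmonic
polynomials. -/
def IsSphericalSum (f : EuclideanSpace ℝ (Fin n) → ℝ) : Prop :=
  ∃ (R : ℕ) (p : ℕ → EuclideanSpace ℝ (Fin n) → ℝ), (∀ m, IsHHP m (p m)) ∧
    ∀ x ∈ sphere (0 : EuclideanSpace ℝ (Fin n)) 1, f x = ∑ m ∈ Finset.range R, p m x

lemma IsSphericalSum.add {f g : EuclideanSpace ℝ (Fin n) → ℝ} (hf : IsSphericalSum f)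
    (hg : IsSphericalSum g) : IsSphericalSum (fun x => f x + g x) := by
  classical
  obtain ⟨R, p, hp, e⟩ := hf
  obtain ⟨S, q, hq, e'⟩ := hg
  have ext : ∀ (R : ℕ) (p : ℕ → EuclideanSpace ℝ (Fin n) → ℝ)
      (x : EuclideanSpace ℝ (Fin n)) (L : ℕ),
      R ≤ L → ∑ m ∈ Finset.range R, p m x =
        ∑ m ∈ Finset.range L, (if m < R then p m x else 0) := by
    intro R p x L hL
    rw [← Finset.sum_filter]
    refine Finset.sum_congr ?_ fun _ _ => rfl
    ext m; simp; omega
  refine ⟨max R S, fun m x => (if m < R then p m x else 0) + (if m < S then q m x else 0),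
    fun m => ?_, fun x hx => ?_⟩
  · refine IsHHP.add (p := fun x => if m < R then p m x else 0) ?_ ?_
    · split_ifs
      · exact hp m
      · exact isHHP_zero m
    · split_ifs
      · exact hq m
      · exact isHHP_zero m
  · beta_reduce
    rw [e x hx, e' x hx, ext R p x _ (le_max_left _ _), ext S q x _ (le_max_right _ _),
      Finset.sum_add_distrib]

lemma IsHHP.isSphericalSum {m : ℕ} {p : EuclideanSpace ℝ (Fin n) → ℝ} (hp : IsHHP m p) :
    IsSphericalSum p := by
  classical
  refine ⟨m + 1, fun k x => if k = m then p x else 0, fun k => ?_, fun x _ => by simp⟩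
  by_cases h : k = m
  · subst h; simpa using hp
  · simpa [h] using isHHP_zero k

lemma eval_polyNormSq (x : EuclideanSpace ℝ (Fin n)) :
    eval (fun i => x i) (polyNormSq n) = ‖x‖ ^ 2 := by
  simp [polyNormSq, EuclideanSpace.real_norm_sq_eq]

lemma isSphericalSum_eval_of_isHomogeneous (hn : 0 < n) (d : ℕ) :
    ∀ f : MvPolynomial (Fin n) ℝ, f.IsHomogeneous d →
      IsSphericalSum (fun x : EuclideanSpace ℝ (Fin n) => eval (fun i => x i) f) := by
  induction d using Nat.strong_induction_on with
  | _ d ih =>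
  intro f hf
  obtain ⟨h, g, hh, hl, hg, hg0, rfl⟩ := exists_harmonic_add_polyNormSq_mul hn hf
  have h1 := (isHHP_eval hh hl).isSphericalSum
  have h2 : IsSphericalSum (fun x : EuclideanSpace ℝ (Fin n) => eval (fun i => x i) g) := by
    rcases lt_or_ge d 2 with hd | hd
    · rw [hg0 hd]; simpa using (isHHP_zero (n := n) 0).isSphericalSum
    · exact ih _ (by omega) g hg
  obtain ⟨R, p, hp, e⟩ := h1.add h2
  refine ⟨R, p, hp, fun x hx => ?_⟩
  rw [← e x hx]
  simp [eval_polyNormSq, mem_sphere_zero_iff_norm.1 hx]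

lemma isSphericalSum_eval (hn : 0 < n) (f : MvPolynomial (Fin n) ℝ) :
    IsSphericalSum (fun x : EuclideanSpace ℝ (Fin n) => eval (fun i => x i) f) := by
  induction f using MvPolynomial.induction_on' with
  | monomial u a =>
    exact isSphericalSum_eval_of_isHomogeneous hn _ _ (isHomogeneous_monomial a rfl)
  | add p q hp hq => simpa using hp.add hq

end Polynomial

section UniformMeasures

open Filter Topology
open scoped ENNReal

variable {X : Type*} [MetricSpace X] [SecondCountableTopology X] [MeasurableSpace X] [BorelSpace X]

lemma measure_open_le_of_tendsto_ratio {μ ν : Measure X} [IsFiniteMeasure μ] [IsFiniteMeasure ν]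
    {f g r : ℕ → ℝ≥0∞} {L : ℝ≥0∞} (hr : Tendsto r atTop (𝓝 0))
    (hf : ∀ k x, μ (Metric.eball x (r k)) = f k) (hg : ∀ k x, ν (Metric.eball x (r k)) = g k)
    (hg0 : ∀ k, g k ≠ 0) (hL : Tendsto (fun k => f k / g k) atTop (𝓝 L)) {U : Set X}
    (hU : IsOpen U) : μ U ≤ L * ν U := by
  rcases isEmpty_or_nonempty X with h | ⟨⟨x₀⟩⟩
  · rw [Set.eq_empty_of_isEmpty U]; simp
  have hgt : ∀ k, g k ≠ ∞ := fun k => by rw [← hg k x₀]; exact measure_ne_top _ _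
  have hmeasS : ∀ k, MeasurableSet {p : X × X | p.2 ∈ U ∧ edist p.1 p.2 < r k} := fun k =>
    (measurable_snd hU.measurableSet).inter
      (measurableSet_lt (measurable_fst.edist measurable_snd) measurable_const)
  have hset : ∀ k (x : X), Prod.mk x ⁻¹' {p : X × X | p.2 ∈ U ∧ edist p.1 p.2 < r k} =
      U ∩ Metric.eball x (r k) := by
    intro k x; ext y; simp [edist_comm]
  have hmeas : ∀ k, Measurable fun x => ν (U ∩ Metric.eball x (r k)) := by
    intro k
    simpa only [hset] using measurable_measure_prodMk_left (ν := ν) (hmeasS k)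
  calc μ U = ∫⁻ x in U, 1 ∂μ := by simp
    _ ≤ ∫⁻ x in U, liminf (fun k => ν (U ∩ Metric.eball x (r k)) / g k) atTop ∂μ := by
        refine setLIntegral_mono' hU.measurableSet fun x hx => ?_
        obtain ⟨ε, hε, hεU⟩ := Metric.isOpen_iff.1 hU x hx
        have : ∀ᶠ k in atTop, r k < ENNReal.ofReal ε :=
          hr.eventually_lt_const (by simpa using hε)
        refine le_liminf_of_le (by isBoundedDefault) ?_
        filter_upwards [this] with k hk
        have : U ∩ Metric.eball x (r k) = Metric.eball x (r k) := by
          refine Set.inter_eq_right.2 (subset_trans ?_ hεU)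
          rw [← Metric.eball_ofReal]
          exact Metric.eball_subset_eball hk.le
        rw [this, hg, ENNReal.div_self (hg0 k) (hgt k)]
    _ ≤ liminf (fun k => ∫⁻ x in U, ν (U ∩ Metric.eball x (r k)) / g k ∂μ) atTop :=
        lintegral_liminf_le fun k => (hmeas k).div_const _
    _ ≤ liminf (fun k => f k / g k * ν U) atTop := by
        refine liminf_le_liminf (Eventually.of_forall fun k => ?_)
        simp only [div_eq_mul_inv]
        rw [lintegral_mul_const _ (hmeas k), mul_right_comm]
        gcongr
        have : ∫⁻ x in U, ν (U ∩ Metric.eball x (r k)) ∂μ =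
            ∫⁻ y in U, μ.restrict U (Metric.eball y (r k)) ∂ν := by
          have e1 := Measure.prod_apply (μ := μ.restrict U) (ν := ν.restrict U)
            (s := {p : X × X | edist p.1 p.2 < r k})
            (measurableSet_lt (measurable_fst.edist measurable_snd) measurable_const)
          have e2 := Measure.prod_apply_symm (μ := μ.restrict U) (ν := ν.restrict U)
            (s := {p : X × X | edist p.1 p.2 < r k})
            (measurableSet_lt (measurable_fst.edist measurable_snd) measurable_const)
          rw [e1] at e2
          convert e2 using 3 with x
          rw [Measure.restrict_apply' hU.measurableSet, Set.inter_comm]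
          congr 2
          · ext y; simp [edist_comm]
          · rfl
        rw [this]
        calc ∫⁻ y in U, μ.restrict U (Metric.eball y (r k)) ∂ν
            ≤ ∫⁻ _ in U, f k ∂ν := lintegral_mono fun y => by
              rw [← hf k y]; exact Measure.restrict_apply_le _ _
          _ = f k * ν U := by simp
    _ = L * ν U :=
        (ENNReal.Tendsto.mul_const hL (Or.inr (measure_ne_top _ _))).liminf_eq

/-- Two uniformly distributed finite measures on a metric space are proportional. -/
theorem exists_eq_smul_of_uniformly_distributed [Nonempty X] {μ ν : Measure X} [IsFiniteMeasure μ]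
    [IsFiniteMeasure ν] (hμ : ∀ (r : ℝ≥0∞) (x y : X), μ (Metric.eball x r) = μ (Metric.eball y r))
    (hν : ∀ (r : ℝ≥0∞) (x y : X), ν (Metric.eball x r) = ν (Metric.eball y r))
    (hμ0 : ∀ (r : ℝ≥0∞) (x : X), r ≠ 0 → μ (Metric.eball x r) ≠ 0)
    (hν0 : ∀ (r : ℝ≥0∞) (x : X), r ≠ 0 → ν (Metric.eball x r) ≠ 0) :
    ∃ c : ℝ≥0∞, c ≠ 0 ∧ c ≠ ∞ ∧ μ = c • ν := by
  obtain ⟨x₀⟩ := ‹Nonempty X›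
  set r₀ : ℕ → ℝ≥0∞ := fun k => ((k : ℝ≥0∞) + 1)⁻¹ with hr₀
  have hr₀pos : ∀ k, r₀ k ≠ 0 := fun k => by simp [hr₀]
  have hr₀lim : Tendsto r₀ atTop (𝓝 0) := by
    have := (tendsto_add_atTop_iff_nat 1).2 ENNReal.tendsto_inv_nat_nhds_zero
    simpa [hr₀] using this
  obtain ⟨L, φ, hφ, hL⟩ := CompactSpace.tendsto_subseq
    (fun k => μ (Metric.eball x₀ (r₀ k)) / ν (Metric.eball x₀ (r₀ k)))
  have hrlim := hr₀lim.comp hφ.tendsto_atTop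
  have hL' : Tendsto (fun k => ν (Metric.eball x₀ (r₀ (φ k))) / μ (Metric.eball x₀ (r₀ (φ k))))
      atTop (𝓝 L⁻¹) := by
    refine (tendsto_inv_iff.2 hL).congr fun k => ?_
    simp only [Function.comp]
    rw [ENNReal.inv_div (Or.inl (measure_ne_top _ _)) (Or.inl (hν0 _ _ (hr₀pos _)))]
  have hle : ∀ {U : Set X}, IsOpen U → μ U ≤ L * ν U := fun hU =>
    measure_open_le_of_tendsto_ratio hrlim (fun k x => hμ _ x x₀) (fun k x => hν _ x x₀)
      (fun k => hν0 _ _ (hr₀pos _)) hL hU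
  have hge : ∀ {U : Set X}, IsOpen U → ν U ≤ L⁻¹ * μ U := fun hU =>
    measure_open_le_of_tendsto_ratio hrlim (fun k x => hν _ x x₀) (fun k x => hμ _ x x₀)
      (fun k => hμ0 _ _ (hr₀pos _)) hL' hU
  have hμu : μ Set.univ ≠ 0 := fun h =>
    hμ0 1 x₀ one_ne_zero (measure_mono_null (Set.subset_univ _) h)
  have hνu : ν Set.univ ≠ 0 := fun h =>
    hν0 1 x₀ one_ne_zero (measure_mono_null (Set.subset_univ _) h)
  have hL0 : L ≠ 0 := by
    rintro rfl
    exact hμu (by simpa using hle isOpen_univ)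
  have hLt : L ≠ ∞ := by
    rintro rfl
    exact hνu (by simpa using hge isOpen_univ)
  refine ⟨L, hL0, hLt, ?_⟩
  refine ext_of_generate_finite {s | IsOpen s} (BorelSpace.measurable_eq) isPiSystem_isOpen
    (fun U hU => ?_) ?_
  all_goals
    rw [Measure.smul_apply, smul_eq_mul]
    refine le_antisymm (hle ?_) ?_
  any_goals first | exact hU | exact isOpen_univ
  · calc L * ν U ≤ L * (L⁻¹ * μ U) := by
          gcongr; exact hge hU
      _ = μ U := by rw [← mul_assoc, ENNReal.mul_inv_cancel hL0 hLt, one_mul]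
  · calc L * ν Set.univ ≤ L * (L⁻¹ * μ Set.univ) := by
          gcongr; exact hge isOpen_univ
      _ = μ Set.univ := by rw [← mul_assoc, ENNReal.mul_inv_cancel hL0 hLt, one_mul]

end UniformMeasures

lemma norm_inv_norm_smul_sub_le {F : Type*} [NormedAddCommGroup F] [NormedSpace ℝ F] {x y : F}
    (hx : 1 ≤ ‖x‖) (hy : 1 ≤ ‖y‖) : ‖‖x‖⁻¹ • x - ‖y‖⁻¹ • y‖ ≤ 2 * ‖x - y‖ := by
  have hx0 : 0 < ‖x‖ := by linarith
  have hy0 : 0 < ‖y‖ := by linarith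
  have h1 : ‖x‖⁻¹ • x - ‖y‖⁻¹ • y = ‖x‖⁻¹ • (x - y) + (‖x‖⁻¹ - ‖y‖⁻¹) • y := by module
  have h2 : |‖x‖⁻¹ - ‖y‖⁻¹| * ‖y‖ = ‖x‖⁻¹ * |‖y‖ - ‖x‖| := by
    rw [inv_sub_inv hx0.ne' hy0.ne', abs_div, abs_of_pos (mul_pos hx0 hy0)]
    field_simp
  have h3 : ‖x‖⁻¹ ≤ 1 := inv_le_one_of_one_le₀ hx
  have h4 : |‖y‖ - ‖x‖| ≤ ‖x - y‖ := by rw [norm_sub_rev]; exact abs_norm_sub_norm_le y x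
  rw [h1]
  refine (norm_add_le _ _).trans ?_
  rw [norm_smul, norm_smul, Real.norm_eq_abs, Real.norm_eq_abs, h2, abs_of_pos (inv_pos.2 hx0)]
  have := mul_le_mul h3 h4 (abs_nonneg _) zero_le_one
  have := mul_le_mul_of_nonneg_right h3 (norm_nonneg (x - y))
  linarith

lemma lipschitzWith_normalize_insertNth {k : ℕ} (i : Fin (k + 1)) {s : ℝ} (hs : |s| = 1) :
    ∃ K, LipschitzWith K (fun y : Fin k → ℝ =>
      (‖(WithLp.toLp 2 (i.insertNth s y : Fin (k + 1) → ℝ) : EuclideanSpace ℝ (Fin (k + 1)))‖⁻¹ •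
        (WithLp.toLp 2 (i.insertNth s y : Fin (k + 1) → ℝ) :
          EuclideanSpace ℝ (Fin (k + 1))))) := by
  obtain ⟨K, hK⟩ : ∃ K, LipschitzWith K (WithLp.toLp 2 :
      (Fin (k + 1) → ℝ) → EuclideanSpace ℝ (Fin (k + 1))) := ⟨_, PiLp.lipschitzWith_toLp 2 _⟩
  refine ⟨2 * K, LipschitzWith.of_dist_le_mul fun y z => ?_⟩
  have h1 : ∀ y : Fin k → ℝ, 1 ≤ ‖(WithLp.toLp 2 (i.insertNth s y : Fin (k + 1) → ℝ) :
      EuclideanSpace ℝ (Fin (k + 1)))‖ := fun y => by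
    have := PiLp.norm_apply_le (WithLp.toLp 2 (i.insertNth s y : Fin (k + 1) → ℝ) :
      EuclideanSpace ℝ (Fin (k + 1))) i
    simpa [hs] using this
  rw [dist_eq_norm]
  refine (norm_inv_norm_smul_sub_le (h1 y) (h1 z)).trans ?_
  rw [← dist_eq_norm]
  have h2 := hK.dist_le_mul (i.insertNth s y : Fin (k + 1) → ℝ) (i.insertNth s z)
  rw [Fin.dist_insertNth_insertNth, dist_self, max_eq_right dist_nonneg] at h2
  push_cast
  linarith

lemma hausdorffMeasure_sphere_ne_top (k : ℕ) :
    μH[(k : ℝ)] (sphere (0 : EuclideanSpace ℝ (Fin (k + 1))) 1) ≠ ⊤ := by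
  set F : Fin (k + 1) × Bool → (Fin k → ℝ) → EuclideanSpace ℝ (Fin (k + 1)) := fun p y =>
    ‖(WithLp.toLp 2 (p.1.insertNth (if p.2 then (1 : ℝ) else -1) y : Fin (k + 1) → ℝ) :
        EuclideanSpace ℝ (Fin (k + 1)))‖⁻¹ •
        (WithLp.toLp 2 (p.1.insertNth (if p.2 then (1 : ℝ) else -1) y : Fin (k + 1) → ℝ) :
          EuclideanSpace ℝ (Fin (k + 1))) with hF
  have hfin : ∀ p, μH[(k : ℝ)] (F p '' closedBall 0 1) < ⊤ := fun p => by
    obtain ⟨K, hK⟩ := lipschitzWith_normalize_insertNth p.1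
      (s := if p.2 then (1 : ℝ) else -1) (by split_ifs <;> simp)
    refine (hK.lipschitzOnWith.hausdorffMeasure_image_le (s := closedBall 0 1)
      (Nat.cast_nonneg k)).trans_lt ?_
    have h := hausdorffMeasure_pi_real (ι := Fin k)
    rw [Fintype.card_fin] at h
    rw [h]
    refine ENNReal.mul_lt_top (ENNReal.rpow_lt_top_of_nonneg (Nat.cast_nonneg k)
      ENNReal.coe_ne_top) ?_
    exact (isCompact_closedBall (0 : Fin k → ℝ) 1).measure_lt_top
  have hsub : sphere (0 : EuclideanSpace ℝ (Fin (k + 1))) 1 ⊆ ⋃ p, F p '' closedBall 0 1 := by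
    intro x hx
    have hx1 : ‖x‖ = 1 := by simpa using hx
    obtain ⟨i, -, hi⟩ := Finset.exists_max_image Finset.univ (fun i => |x i|)
      ⟨0, Finset.mem_univ _⟩
    have hi0 : x i ≠ 0 := by
      intro h0
      have : x = 0 := by
        ext j
        have := hi j (Finset.mem_univ _)
        rw [h0, abs_zero] at this
        simpa using abs_nonpos_iff.1 this
      rw [this, norm_zero] at hx1
      exact zero_ne_one hx1
    have hpos : 0 < |x i| := abs_pos.2 hi0
    refine Set.mem_iUnion.2 ⟨(i, decide (0 < x i)), fun j => |x i|⁻¹ * x (i.succAbove j), ?_, ?_⟩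
    · rw [mem_closedBall_zero_iff, pi_norm_le_iff_of_nonneg zero_le_one]
      intro j
      rw [norm_mul, norm_inv, Real.norm_eq_abs, Real.norm_eq_abs, abs_abs, inv_mul_le_iff₀ hpos,
        mul_one]
      exact hi _ (Finset.mem_univ _)
    · have : (WithLp.toLp 2 (i.insertNth (if (decide (0 < x i)) then (1 : ℝ) else -1)
          (fun j => |x i|⁻¹ * x (i.succAbove j)) : Fin (k + 1) → ℝ) :
          EuclideanSpace ℝ (Fin (k + 1))) = |x i|⁻¹ • x := by
        ext j
        refine Fin.succAboveCases i ?_ (fun j => ?_) j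
        · simp only [Fin.insertNth_apply_same, PiLp.smul_apply, smul_eq_mul, decide_eq_true_eq]
          split_ifs with h
          · rw [abs_of_pos h, inv_mul_cancel₀ hi0]
          · have : x i < 0 := lt_of_le_of_ne (not_lt.1 h) hi0
            rw [abs_of_neg this]
            field_simp
        · simp
      simp only [hF]
      rw [this, norm_smul, hx1, norm_inv, Real.norm_eq_abs, abs_abs, mul_one, inv_inv, smul_smul,
        mul_inv_cancel₀ hpos.ne', one_smul]
  refine ((measure_mono hsub).trans_lt ?_).ne
  refine (measure_iUnion_le _).trans_lt ?_
  rw [tsum_fintype]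
  exact ENNReal.sum_lt_top.2 fun p _ => hfin p

lemma hausdorffMeasure_sphere_ne_zero (k : ℕ) :
    μH[(k : ℝ)] (sphere (0 : EuclideanSpace ℝ (Fin (k + 1))) 1) ≠ 0 := by
  set P : EuclideanSpace ℝ (Fin (k + 1)) → (Fin k → ℝ) := fun x j => x j.succ with hP
  have hPl : LipschitzWith 1 P := by
    refine LipschitzWith.of_dist_le_mul fun x y => ?_
    rw [NNReal.coe_one, one_mul, dist_pi_le_iff dist_nonneg]
    intro j
    simp only [hP]
    rw [dist_eq_norm, dist_eq_norm]
    exact PiLp.norm_apply_le (x - y) j.succ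
  have hle := hPl.lipschitzOnWith.hausdorffMeasure_image_le
    (s := sphere (0 : EuclideanSpace ℝ (Fin (k + 1))) 1) (d := k) (Nat.cast_nonneg k)
  intro h0
  have h := hausdorffMeasure_pi_real (ι := Fin k)
  rw [Fintype.card_fin] at h
  rw [h0, mul_zero, h] at hle
  set U : Set (Fin k → ℝ) := {y | ∑ j, y j ^ 2 < 1} with hU
  have hUo : IsOpen U := isOpen_lt (by fun_prop) continuous_const
  have hUs : U ⊆ P '' sphere (0 : EuclideanSpace ℝ (Fin (k + 1))) 1 := by
    intro y hy
    refine ⟨WithLp.toLp 2 (Fin.cons (Real.sqrt (1 - ∑ j, y j ^ 2)) y), ?_, ?_⟩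
    · rw [mem_sphere_zero_iff_norm, EuclideanSpace.norm_eq, Real.sqrt_eq_one, Fin.sum_univ_succ]
      have : 0 ≤ 1 - ∑ j, y j ^ 2 := by
        have : ∑ j, y j ^ 2 < 1 := hy
        linarith
      simp [Real.sq_sqrt this]
    · ext j
      simp [hP]
  have := hUo.measure_pos volume ⟨0, by simp [hU]⟩
  exact absurd (this.trans_le ((measure_mono hUs).trans hle)) (by simp)

lemma exists_linearIsometryEquiv_apply_eq {n : ℕ} {x y : EuclideanSpace ℝ (Fin n)}
    (h : ‖x‖ = ‖y‖) :
    ∃ R : EuclideanSpace ℝ (Fin n) ≃ₗᵢ[ℝ] EuclideanSpace ℝ (Fin n), R x = y := by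
  exact ⟨_, Submodule.reflection_sub h⟩

lemma image_eball_inter_sphere {n : ℕ}
    (R : EuclideanSpace ℝ (Fin n) ≃ₗᵢ[ℝ] EuclideanSpace ℝ (Fin n)) (x : EuclideanSpace ℝ (Fin n))
    (r : ENNReal) :
    R '' (eball x r ∩ sphere 0 1) = eball (R x) r ∩ sphere 0 1 := by
  ext z
  constructor
  · rintro ⟨y, ⟨h1, h2⟩, rfl⟩
    refine ⟨?_, by simpa using h2⟩
    rw [mem_eball, R.isometry.edist_eq]; exact h1
  · rintro ⟨h1, h2⟩
    refine ⟨R.symm z, ⟨?_, by simpa using h2⟩, by simp⟩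
    rw [mem_eball, ← R.isometry.edist_eq]
    simpa using h1

lemma coe_image_eball {n : ℕ} (x : sphere (0 : EuclideanSpace ℝ (Fin n)) 1) (r : ENNReal) :
    ((↑) : sphere (0 : EuclideanSpace ℝ (Fin n)) 1 → _) '' eball x r
      = eball (x : EuclideanSpace ℝ (Fin n)) r ∩ sphere 0 1 := by
  ext z
  constructor
  · rintro ⟨y, h, rfl⟩
    exact ⟨h, y.2⟩
  · rintro ⟨h1, h2⟩
    exact ⟨⟨z, h2⟩, h1, rfl⟩

lemma hausdorffMeasure_eball_inter_sphere_eq {n : ℕ} (d : ℝ)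
    (x y : sphere (0 : EuclideanSpace ℝ (Fin n)) 1) (r : ENNReal) :
    μH[d] (eball (x : EuclideanSpace ℝ (Fin n)) r ∩ sphere 0 1)
      = μH[d] (eball (y : EuclideanSpace ℝ (Fin n)) r ∩ sphere 0 1) := by
  obtain ⟨R, hR⟩ := exists_linearIsometryEquiv_apply_eq (x := (x : EuclideanSpace ℝ (Fin n)))
    (y := y) (by rw [norm_eq_of_mem_sphere, norm_eq_of_mem_sphere])
  rw [← hR, ← image_eball_inter_sphere, R.isometry.hausdorffMeasure_image (Or.inr R.surjective)]

open scoped Pointwise in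
lemma toSphere_eball_eq {n : ℕ} (x y : sphere (0 : EuclideanSpace ℝ (Fin n)) 1) (r : ENNReal) :
    (volume : Measure (EuclideanSpace ℝ (Fin n))).toSphere (eball x r)
      = (volume : Measure (EuclideanSpace ℝ (Fin n))).toSphere (eball y r) := by
  rw [Measure.toSphere_apply' _ isOpen_eball.measurableSet,
    Measure.toSphere_apply' _ isOpen_eball.measurableSet, coe_image_eball, coe_image_eball]
  congr 1
  obtain ⟨R, hR⟩ := exists_linearIsometryEquiv_apply_eq (x := (x : EuclideanSpace ℝ (Fin n)))
    (y := y) (by rw [norm_eq_of_mem_sphere, norm_eq_of_mem_sphere])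
  rw [← hR, ← image_eball_inter_sphere]
  have : Set.Ioo (0 : ℝ) 1 • (R '' (eball (x : EuclideanSpace ℝ (Fin n)) r ∩ sphere 0 1))
      = R.symm ⁻¹' (Set.Ioo (0 : ℝ) 1 • (eball (x : EuclideanSpace ℝ (Fin n)) r ∩ sphere 0 1)) := by
    ext z
    constructor
    · rintro ⟨a, ha, -, ⟨b, hb, rfl⟩, rfl⟩
      exact ⟨a, ha, b, hb, by simp⟩
    · rintro ⟨a, ha, b, hb, h⟩
      refine ⟨a, ha, R b, ⟨b, hb, rfl⟩, ?_⟩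
      have := congrArg R h
      simpa using this
  rw [this]
  exact (R.symm.measurePreserving.measure_preimage_equiv (f := R.symm.toMeasurableEquiv) _).symm

theorem exists_hausdorffMeasure_sphere_eq_smul (k : ℕ) :
    ∃ c : ENNReal, c ≠ 0 ∧ c ≠ ⊤ ∧
      (μH[(k : ℝ)] : Measure (EuclideanSpace ℝ (Fin (k + 1)))).comap
        (Subtype.val : sphere (0 : EuclideanSpace ℝ (Fin (k + 1))) 1 → _)
        = c • (volume : Measure (EuclideanSpace ℝ (Fin (k + 1)))).toSphere := by
  set σ := (μH[(k : ℝ)] : Measure (EuclideanSpace ℝ (Fin (k + 1)))).comap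
        (Subtype.val : sphere (0 : EuclideanSpace ℝ (Fin (k + 1))) 1 → _) with hσ
  have hemb : MeasurableEmbedding
      (Subtype.val : sphere (0 : EuclideanSpace ℝ (Fin (k + 1))) 1 → _) :=
    MeasurableEmbedding.subtype_coe isClosed_sphere.measurableSet
  have hap : ∀ s, σ s = μH[(k : ℝ)]
      ((Subtype.val : sphere (0 : EuclideanSpace ℝ (Fin (k + 1))) 1 → _) '' s)
    := fun s => hemb.comap_apply _ _
  have huniv : σ Set.univ = μH[(k : ℝ)] (sphere (0 : EuclideanSpace ℝ (Fin (k + 1))) 1) := by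
    rw [hap, Set.image_univ, Subtype.range_coe]
  have : IsFiniteMeasure σ := ⟨by rw [huniv]; exact (hausdorffMeasure_sphere_ne_top k).lt_top⟩
  have : Nonempty (sphere (0 : EuclideanSpace ℝ (Fin (k + 1))) 1) :=
    (NormedSpace.sphere_nonempty.2 zero_le_one).to_subtype
  have hσball : ∀ r x y, σ (eball x r) = σ (eball y r) := fun r x y => by
    rw [hap, hap, coe_image_eball, coe_image_eball]
    exact hausdorffMeasure_eball_inter_sphere_eq _ x y r
  refine exists_eq_smul_of_uniformly_distributed hσball (fun r x y => toSphere_eball_eq x y r) ?_ ?_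
  · intro r x hr h0
    obtain ⟨t, -, ht⟩ := (isCompact_univ (X := sphere (0 : EuclideanSpace ℝ (Fin (k + 1))) 1)
      ).elim_nhds_subcover (fun y => eball y r) fun y _ =>
        isOpen_eball.mem_nhds (mem_eball_self (pos_iff_ne_zero.2 hr))
    have : σ Set.univ = 0 := by
      refine measure_mono_null ht ((measure_biUnion_null_iff t.countable_toSet).2 fun y _ => ?_)
      rw [hσball r y x, h0]
    rw [huniv] at this
    exact hausdorffMeasure_sphere_ne_zero k this
  · intro r x hr
    exact isOpen_eball.measure_ne_zero _ ⟨x, mem_eball_self (pos_iff_ne_zero.2 hr)⟩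

theorem exists_setIntegral_sphere_eq (k : ℕ) :
    ∃ c : ℝ, 0 < c ∧ ∀ f : EuclideanSpace ℝ (Fin (k + 1)) → ℝ,
      ∫ x in sphere (0 : EuclideanSpace ℝ (Fin (k + 1))) 1, f x ∂μH[(k : ℝ)]
        = c * ∫ ω, f (ω : EuclideanSpace ℝ (Fin (k + 1)))
          ∂(volume : Measure (EuclideanSpace ℝ (Fin (k + 1)))).toSphere := by
  obtain ⟨c, h0, ht, h⟩ := exists_hausdorffMeasure_sphere_eq_smul k
  refine ⟨c.toReal, ENNReal.toReal_pos h0 ht, fun f => ?_⟩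
  rw [← integral_subtype_comap isClosed_sphere.measurableSet, h, integral_smul_measure, smul_eq_mul]

lemma integral_eq_of_weighted_integral_eq {a b : ℝ → ℝ} (ha : Continuous a) (hb : Continuous b)
    (h : ∀ R : ℝ, 0 < R → ∫ r in 0..R, (R ^ 2 - r ^ 2) ^ 2 * a r
      = ∫ r in 0..R, 4 * (R ^ 2 - r ^ 2) * (r * b r)) {R : ℝ} (hR : 0 < R) :
    ∫ r in 0..R, a r = b R := by
  have D : ∀ {f : ℝ → ℝ}, Continuous f → ∀ x : ℝ,
      HasDerivAt (fun R => ∫ r in (0 : ℝ)..R, f r) (f x) x := fun hf x =>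
    intervalIntegral.integral_hasDerivAt_right (hf.intervalIntegrable _ _)
      (hf.stronglyMeasurableAtFilter _ _) hf.continuousAt
  have I : ∀ {f : ℝ → ℝ}, Continuous f → ∀ x : ℝ, IntervalIntegrable f volume 0 x :=
    fun hf x => hf.intervalIntegrable _ _
  have c2 : Continuous fun r => r ^ 2 * a r := by fun_prop
  have c4 : Continuous fun r => r ^ 4 * a r := by fun_prop
  have d1 : Continuous fun r => r * b r := by fun_prop
  have d3 : Continuous fun r => r ^ 3 * b r := by fun_prop
  have h1 : ∀ R : ℝ, 0 < R → R ^ 4 * (∫ r in 0..R, a r) - 2 * R ^ 2 * (∫ r in 0..R, r ^ 2 * a r)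
      + (∫ r in 0..R, r ^ 4 * a r)
      = 4 * R ^ 2 * (∫ r in 0..R, r * b r) - 4 * (∫ r in 0..R, r ^ 3 * b r) := fun R hR => by
    have e := h R hR
    have e1 : ∫ r in 0..R, (R ^ 2 - r ^ 2) ^ 2 * a r = ∫ r in 0..R, (R ^ 4 * a r
        - 2 * R ^ 2 * (r ^ 2 * a r) + r ^ 4 * a r) := by
      congr 1; ext r; ring
    have e2 : ∫ r in 0..R, 4 * (R ^ 2 - r ^ 2) * (r * b r)
        = ∫ r in 0..R, (4 * R ^ 2 * (r * b r) - 4 * (r ^ 3 * b r)) := by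
      congr 1; ext r; ring
    rw [e1, e2, intervalIntegral.integral_add (((I ha R).const_mul _).sub ((I c2 R).const_mul _))
      (I c4 R), intervalIntegral.integral_sub ((I ha R).const_mul _) ((I c2 R).const_mul _),
      intervalIntegral.integral_sub ((I d1 R).const_mul _) ((I d3 R).const_mul _),
      intervalIntegral.integral_const_mul, intervalIntegral.integral_const_mul,
      intervalIntegral.integral_const_mul, intervalIntegral.integral_const_mul] at e
    exact e
  have h2 : ∀ R : ℝ, 0 < R → R ^ 2 * (∫ r in 0..R, a r) - (∫ r in 0..R, r ^ 2 * a r)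
      = 2 * ∫ r in 0..R, r * b r := fun R hR => by
    have l := ((((hasDerivAt_id R).pow 4).mul (D ha R)).sub
      ((((hasDerivAt_id R).pow 2).const_mul 2).mul (D c2 R))).add (D c4 R)
    have r := ((((hasDerivAt_id R).pow 2).const_mul 4).mul (D d1 R)).sub ((D d3 R).const_mul 4)
    have e := l.unique (r.congr_of_eventuallyEq (by
      filter_upwards [lt_mem_nhds hR] with x hx
      simpa using h1 x hx))
    simp only [id, Pi.pow_apply] at e
    have : (4 * R) * (R ^ 2 * (∫ r in 0..R, a r) - (∫ r in 0..R, r ^ 2 * a r)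
      - 2 * ∫ r in 0..R, r * b r) = 0 := by
      norm_num at e
      linear_combination e
    have := (mul_eq_zero.1 this).resolve_left (by positivity)
    linarith
  have l := (((hasDerivAt_id R).pow 2).mul (D ha R)).sub (D c2 R)
  have r := (D d1 R).const_mul 2
  have e := l.unique (r.congr_of_eventuallyEq (by
    filter_upwards [lt_mem_nhds hR] with x hx
    simpa using h2 x hx))
  simp only [id, Pi.pow_apply] at e
  have : (2 * R) * ((∫ r in 0..R, a r) - b R) = 0 := by
    norm_num at e
    linear_combination e
  have := (mul_eq_zero.1 this).resolve_left (by positivity)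
  linarith

lemma hasDerivAt_max_zero_sq (t : ℝ) :
    HasDerivAt (fun t : ℝ => max 0 t ^ 2) (2 * max 0 t) t := by
  rcases lt_trichotomy t 0 with h | rfl | h
  · rw [max_eq_left h.le, mul_zero]
    refine (hasDerivAt_const t (0 : ℝ)).congr_of_eventuallyEq ?_
    filter_upwards [gt_mem_nhds h] with s hs
    simp [max_eq_left (le_of_lt hs)]
  · rw [max_self, mul_zero, hasDerivAt_iff_isLittleO_nhds_zero]
    have : (fun h : ℝ => h ^ 2) =o[nhds 0] fun h => h := by
      simpa using Asymptotics.isLittleO_pow_id (𝕜 := ℝ) (n := 2) (by norm_num)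
    refine Asymptotics.IsBigO.trans_isLittleO (Asymptotics.IsBigO.of_bound 1 ?_) this
    refine Filter.Eventually.of_forall fun s => ?_
    simp only [zero_add, max_self, smul_zero, sub_zero, norm_pow, one_mul]
    have : ‖max 0 s‖ ≤ ‖s‖ := by
      rw [Real.norm_eq_abs, Real.norm_eq_abs, abs_of_nonneg (le_max_left _ _)]
      exact max_le (abs_nonneg s) (le_abs_self s)
    simp only [ne_eq, OfNat.ofNat_ne_zero, not_false_eq_true, zero_pow, sub_zero, norm_pow]
    gcongr
  · rw [max_eq_right h.le]
    have h2 : HasDerivAt (fun t : ℝ => t ^ 2) (2 * t) t := by simpa using hasDerivAt_pow 2 t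
    refine h2.congr_of_eventuallyEq ?_
    filter_upwards [lt_mem_nhds h] with s hs
    rw [max_eq_right (le_of_lt hs)]

theorem integral_eq_integral_Ioi_toSphere {k : ℕ} {f : EuclideanSpace ℝ (Fin (k + 1)) → ℝ}
    (hf : Integrable f) :
    ∫ x, f x = ∫ r in Set.Ioi (0 : ℝ), r ^ k * ∫ ω, f (r • (ω : EuclideanSpace ℝ (Fin (k + 1))))
      ∂(volume : Measure (EuclideanSpace ℝ (Fin (k + 1)))).toSphere := by
  have hdim : Module.finrank ℝ (EuclideanSpace ℝ (Fin (k + 1))) - 1 = k := by simp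
  have mp :=
    (volume : Measure (EuclideanSpace ℝ (Fin (k + 1)))).measurePreserving_homeomorphUnitSphereProd
  have hemb := Homeomorph.measurableEmbedding
    (homeomorphUnitSphereProd (EuclideanSpace ℝ (Fin (k + 1))))
  rw [hdim] at mp
  set g : sphere (0 : (EuclideanSpace ℝ (Fin (k + 1)))) 1 × Set.Ioi (0 : ℝ) → ℝ :=
      fun p => f ((p.2 : ℝ) • (p.1 : (EuclideanSpace ℝ (Fin (k + 1))))) with hg
  have hfg : ∀ x : ({0}ᶜ : Set (EuclideanSpace ℝ (Fin (k + 1)))),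
      g (homeomorphUnitSphereProd (EuclideanSpace ℝ (Fin (k + 1))) x) = f x := fun x => by
    have h0 : ‖(x : (EuclideanSpace ℝ (Fin (k + 1))))‖ ≠ 0 := norm_ne_zero_iff.2 x.2
    simp [hg, smul_smul, h0]
  have hint : Integrable g ((volume : Measure (EuclideanSpace ℝ (Fin (k + 1)))).toSphere.prod
      (Measure.volumeIoiPow k)) := by
    rw [← mp.integrable_comp_emb hemb]
    have : g ∘ homeomorphUnitSphereProd (EuclideanSpace ℝ (Fin (k + 1))) = f ∘ Subtype.val :=
        funext hfg
    rw [this]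
    exact (integrableOn_iff_comap_subtypeVal (measurableSet_singleton _).compl).1 hf.integrableOn
  calc ∫ x, f x = ∫ x : ({(0)}ᶜ : Set (EuclideanSpace ℝ (Fin (k + 1)))), f x.1
      ∂((volume : Measure (EuclideanSpace ℝ (Fin (k + 1)))).comap (↑)) := by
        rw [integral_subtype_comap (measurableSet_singleton _).compl fun x ↦ f x,
          restrict_compl_singleton]
    _ = ∫ p, g p ∂((volume : Measure (EuclideanSpace ℝ (Fin (k + 1)))).toSphere.prod
        (Measure.volumeIoiPow k)) := by
        rw [← mp.integral_comp hemb]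
        exact integral_congr_ae (Filter.Eventually.of_forall fun x => (hfg x).symm)
    _ = ∫ r, ∫ ω, g (ω, r) ∂(volume : Measure (EuclideanSpace ℝ (Fin (k + 1)))).toSphere
        ∂(Measure.volumeIoiPow k) := integral_prod_symm _ hint
    _ = _ := by
        simp only [Measure.volumeIoiPow, ENNReal.ofReal]
        rw [integral_withDensity_eq_integral_smul
          (measurable_subtype_coe.pow_const _).real_toNNReal,
          integral_subtype_comap measurableSet_Ioi
          fun a ↦ Real.toNNReal (a ^ k) • ∫ ω, f (a • (ω : (EuclideanSpace ℝ (Fin (k + 1)))))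
              ∂(volume : Measure (EuclideanSpace ℝ (Fin (k + 1)))).toSphere]
        refine setIntegral_congr_fun measurableSet_Ioi fun x hx => ?_
        simp only [NNReal.smul_def, Real.coe_toNNReal _ (pow_nonneg (le_of_lt hx) k), smul_eq_mul]

theorem setIntegral_closedBall_eq_integral_toSphere {k : ℕ}
    {f : EuclideanSpace ℝ (Fin (k + 1)) → ℝ} (hf : Continuous f) {R : ℝ} (hR : 0 ≤ R) :
    ∫ x in closedBall 0 R, f x
      = ∫ r in 0..R, r ^ k * ∫ ω, f (r • (ω : EuclideanSpace ℝ (Fin (k + 1))))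
      ∂(volume : Measure (EuclideanSpace ℝ (Fin (k + 1)))).toSphere := by
  have hint : IntegrableOn f (closedBall 0 R) :=
    hf.continuousOn.integrableOn_compact (isCompact_closedBall _ _)
  rw [← integral_indicator isClosed_closedBall.measurableSet, integral_eq_integral_Ioi_toSphere
    (hint.integrable_indicator isClosed_closedBall.measurableSet),
        intervalIntegral.integral_of_le hR]
  have : Set.Ioc 0 R = Set.Ioi 0 ∩ Set.Iic R := rfl
  rw [this, ← setIntegral_indicator measurableSet_Iic]
  refine setIntegral_congr_fun measurableSet_Ioi fun r hr => ?_
  have hn : ∀ ω : sphere (0 : EuclideanSpace ℝ (Fin (k + 1))) 1,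
      ‖r • (ω : EuclideanSpace ℝ (Fin (k + 1)))‖ = r := fun ω => by
    rw [norm_smul, norm_eq_of_mem_sphere, mul_one, Real.norm_eq_abs, abs_of_pos hr]
  by_cases h : r ≤ R
  · rw [Set.indicator_of_mem (show r ∈ Set.Iic R from h)]
    refine congrArg (r ^ k * ·) ?_
    refine integral_congr_ae (Filter.Eventually.of_forall fun ω => ?_)
    exact Set.indicator_of_mem (by simpa [hn ω] using h) _
  · rw [Set.indicator_of_notMem (show r ∉ Set.Iic R from h)]
    have : ∀ ω : sphere (0 : EuclideanSpace ℝ (Fin (k + 1))) 1,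
      (closedBall 0 R).indicator f (r • (ω : EuclideanSpace ℝ (Fin (k + 1)))) = 0 := fun ω =>
        Set.indicator_of_notMem (by simpa [hn ω] using h) _
    simp [this]

lemma continuous_integral_toSphere_smul {k : ℕ} {F : ℝ → EuclideanSpace ℝ (Fin (k + 1)) → ℝ}
    (hF : Continuous F.uncurry) :
    Continuous fun r : ℝ => ∫ ω, F r (ω : EuclideanSpace ℝ (Fin (k + 1)))
      ∂(volume : Measure (EuclideanSpace ℝ (Fin (k + 1)))).toSphere := by
  have := continuous_parametric_integral_of_continuous
    (μ := (volume : Measure (EuclideanSpace ℝ (Fin (k + 1)))).toSphere)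
    (f := fun (r : ℝ) (ω : sphere (0 : EuclideanSpace ℝ (Fin (k + 1))) 1) => F r ω)
    (hF.comp (continuous_fst.prodMk (continuous_subtype_val.comp continuous_snd)))
    (isCompact_univ)
  simpa using this

lemma continuous_pd {n : ℕ} {g : EuclideanSpace ℝ (Fin n) → ℝ} (hg : ContDiff ℝ 1 g) (i : Fin n) :
    Continuous (pd i g) :=
  (hg.continuous_fderiv one_ne_zero).clm_apply continuous_const

lemma setIntegral_weight_mul_pd {n : ℕ} {g : EuclideanSpace ℝ (Fin n) → ℝ} (hg : ContDiff ℝ 1 g)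
    (i : Fin n) {R : ℝ} (hR : 0 < R) :
    ∫ x in closedBall 0 R, (R ^ 2 - ‖x‖ ^ 2) ^ 2 * pd i g x
      = ∫ x in closedBall 0 R, 4 * (R ^ 2 - ‖x‖ ^ 2) * (x i * g x) := by
  set e : (EuclideanSpace ℝ (Fin n)) := EuclideanSpace.single i (1 : ℝ)
  set f : (EuclideanSpace ℝ (Fin n)) → ℝ := fun x => max 0 (R ^ 2 - ‖x‖ ^ 2) ^ 2 with hf
  have hfd : ∀ x, HasFDerivAt f ((2 * max 0 (R ^ 2 - ‖x‖ ^ 2)) • -((2 : ℕ) • innerSL ℝ x :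
      (EuclideanSpace ℝ (Fin n)) →L[ℝ] ℝ)) x := fun x =>
    (hasDerivAt_max_zero_sq _).comp_hasFDerivAt x
      ((hasStrictFDerivAt_norm_sq x).hasFDerivAt.const_sub (R ^ 2))
  have hfe : ∀ x, fderiv ℝ f x e = -(4 * max 0 (R ^ 2 - ‖x‖ ^ 2) * x i) := fun x => by
    rw [(hfd x).fderiv]
    simp only [smul_apply, neg_apply, innerSL_apply_apply,
      smul_eq_mul, nsmul_eq_mul, e, EuclideanSpace.inner_single_right]
    simp
    ring
  have hz : ∀ x, x ∉ closedBall (0 : (EuclideanSpace ℝ (Fin n))) R → max 0 (R ^ 2 - ‖x‖ ^ 2) = 0 :=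
      fun x hx => by
    rw [mem_closedBall_zero_iff, not_le] at hx
    exact max_eq_left (by nlinarith)
  have hp : ∀ x ∈ closedBall (0 : (EuclideanSpace ℝ (Fin n))) R, max 0 (R ^ 2 - ‖x‖ ^ 2) =
      R ^ 2 - ‖x‖ ^ 2 := fun x hx => by
    rw [mem_closedBall_zero_iff] at hx
    exact max_eq_right (by nlinarith [norm_nonneg x])
  have hint : ∀ F : (EuclideanSpace ℝ (Fin n)) → ℝ, Continuous F →
      (∀ x, x ∉ closedBall (0 : (EuclideanSpace ℝ (Fin n))) R → F x = 0) →
      Integrable F := fun F hF h0 =>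
    hF.integrable_of_hasCompactSupport (HasCompactSupport.intro (isCompact_closedBall _ _) h0)
  have hgc := hg.continuous
  have hgc' := continuous_pd hg i
  have key := integral_mul_fderiv_eq_neg_fderiv_mul_of_integrable
    (μ := (volume : Measure (EuclideanSpace ℝ (Fin n))))
    (f := f) (g := g) (v := e)
    (by
      simp only [hfe]
      exact hint _ (by fun_prop) fun x hx => by simp [hz x hx])
    (by
      refine hint _ (Continuous.mul (by fun_prop) hgc') fun x hx => ?_
      simp [hf, hz x hx])
    (hint _ (by fun_prop) fun x hx => by simp [hf, hz x hx])
    (fun x _ => (hfd x).differentiableAt)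
    (fun x _ => hg.differentiable one_ne_zero x)
  rw [← setIntegral_eq_integral_of_forall_compl_eq_zero (s := closedBall 0 R)
    (f := fun x => f x * fderiv ℝ g x e) (fun x hx => by simp [hf, hz x hx]),
    ← setIntegral_eq_integral_of_forall_compl_eq_zero (s := closedBall 0 R)
    (f := fun x => fderiv ℝ f x e * g x) (fun x hx => by simp [hfe, hz x hx]),
        ← integral_neg] at key
  refine Eq.trans (setIntegral_congr_fun isClosed_closedBall.measurableSet fun x hx => ?_)
    (key.trans (setIntegral_congr_fun isClosed_closedBall.measurableSet fun x hx => ?_))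
  · simp only [hf, hp x hx, pd, e]
  · simp only [hfe, hp x hx]
    ring

/-- The divergence theorem on the unit ball, one coordinate direction at a time. -/
theorem setIntegral_closedBall_pd {k : ℕ} {g : EuclideanSpace ℝ (Fin (k + 1)) → ℝ}
    (hg : ContDiff ℝ 1 g) (i : Fin (k + 1)) :
    ∫ x in closedBall 0 1, pd i g x
      = ∫ ω, (ω : EuclideanSpace ℝ (Fin (k + 1))) i * g ω
        ∂(volume : Measure (EuclideanSpace ℝ (Fin (k + 1)))).toSphere := by
  have hgc := hg.continuous
  have hgc' := continuous_pd hg i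
  rw [setIntegral_closedBall_eq_integral_toSphere hgc' zero_le_one]
  have hn : ∀ (r : ℝ) (ω : sphere (0 : EuclideanSpace ℝ (Fin (k + 1))) 1),
      ‖r • (ω : EuclideanSpace ℝ (Fin (k + 1)))‖ ^ 2 = r ^ 2 := fun r ω => by
    rw [norm_smul, norm_eq_of_mem_sphere, mul_one, Real.norm_eq_abs, sq_abs]
  rw [integral_eq_of_weighted_integral_eq
    (b := fun r => r ^ k * ∫ ω, (ω : EuclideanSpace ℝ (Fin (k + 1))) i *
      g (r • (ω : EuclideanSpace ℝ (Fin (k + 1))))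
      ∂(volume : Measure (EuclideanSpace ℝ (Fin (k + 1)))).toSphere) ?_ ?_ ?_ one_pos]
  · simp
  · exact (continuous_pow k).mul (continuous_integral_toSphere_smul
      (F := fun r ω => pd i g (r • ω)) (hgc'.comp (by fun_prop)))
  · refine (continuous_pow k).mul (continuous_integral_toSphere_smul
      (F := fun r ω => ω i * g (r • ω)) ?_)
    unfold Function.uncurry
    fun_prop
  · intro R hR
    have := setIntegral_weight_mul_pd hg i hR
    rw [setIntegral_closedBall_eq_integral_toSphere (by fun_prop) hR.le,
      setIntegral_closedBall_eq_integral_toSphere (by fun_prop) hR.le] at this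
    convert this using 3 with r r
    · simp only [hn, integral_const_mul]
      ring
    · simp only [hn, integral_const_mul, PiLp.smul_apply, smul_eq_mul, mul_assoc]
      ring

lemma integrable_toSphere {k : ℕ} {f : EuclideanSpace ℝ (Fin (k + 1)) → ℝ} (hf : Continuous f) :
    Integrable (fun ω : sphere (0 : EuclideanSpace ℝ (Fin (k + 1))) 1 =>
      f (ω : EuclideanSpace ℝ (Fin (k + 1))))
      (volume : Measure (EuclideanSpace ℝ (Fin (k + 1)))).toSphere :=
  (hf.comp continuous_subtype_val).integrable_of_hasCompactSupport
    (HasCompactSupport.of_compactSpace _)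

lemma integrableOn_closedBall_of_continuous {n : ℕ} {f : EuclideanSpace ℝ (Fin n) → ℝ}
    (hf : Continuous f) (x : EuclideanSpace ℝ (Fin n)) (r : ℝ) :
    IntegrableOn f (closedBall x r) :=
  hf.continuousOn.integrableOn_compact (isCompact_closedBall _ _)

lemma pd_mul {n : ℕ} {f g : EuclideanSpace ℝ (Fin n) → ℝ} (hf : ContDiff ℝ 1 f)
    (hg : ContDiff ℝ 1 g) (i : Fin n) (x : EuclideanSpace ℝ (Fin n)) :
    pd i (fun y => f y * g y) x = pd i f x * g x + f x * pd i g x := by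
  have := ((hf.differentiable one_ne_zero x).hasFDerivAt.mul
    (hg.differentiable one_ne_zero x).hasFDerivAt).fderiv
  unfold pd
  change fderiv ℝ (f * g) x _ = _
  rw [this]
  simp
  ring

lemma pd_coord {n : ℕ} (i : Fin n) (x : EuclideanSpace ℝ (Fin n)) :
    pd i (fun y => y i) x = 1 := by
  have : HasFDerivAt (fun y : EuclideanSpace ℝ (Fin n) => y i)
      (EuclideanSpace.proj i : EuclideanSpace ℝ (Fin n) →L[ℝ] ℝ) x :=
    (EuclideanSpace.proj i : EuclideanSpace ℝ (Fin n) →L[ℝ] ℝ).hasFDerivAt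
  unfold pd
  rw [this.fderiv]
  simp

lemma contDiff_coord {n : ℕ} (i : Fin n) : ContDiff ℝ 1 (fun y : EuclideanSpace ℝ (Fin n) => y i) :=
  (EuclideanSpace.proj i : EuclideanSpace ℝ (Fin n) →L[ℝ] ℝ).contDiff

lemma IsHHP.exists_eval {n m : ℕ} {p : EuclideanSpace ℝ (Fin n) → ℝ} (hp : IsHHP m p) :
    ∃ q : MvPolynomial (Fin n) ℝ, q.IsHomogeneous m ∧
      p = fun x => MvPolynomial.eval (fun i => x i) q := by
  obtain ⟨q, hq, h, -⟩ := hp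
  exact ⟨q, hq, funext h⟩

lemma IsHHP.contDiff {n m : ℕ} {p : EuclideanSpace ℝ (Fin n) → ℝ} (hp : IsHHP m p) :
    ContDiff ℝ 1 p := by
  obtain ⟨q, -, rfl⟩ := hp.exists_eval
  exact (contDiff_eval q).of_le le_top

lemma IsHHP.contDiff_pd {n m : ℕ} {p : EuclideanSpace ℝ (Fin n) → ℝ} (hp : IsHHP m p)
    (i : Fin n) : ContDiff ℝ 1 (pd i p) := by
  obtain ⟨q, -, rfl⟩ := hp.exists_eval
  rw [pd_eval]
  exact (contDiff_eval _).of_le le_top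

lemma IsHHP.sum_mul_pd {n m : ℕ} {p : EuclideanSpace ℝ (Fin n) → ℝ} (hp : IsHHP m p)
    (x : EuclideanSpace ℝ (Fin n)) : ∑ i, x i * pd i p x = m * p x := by
  obtain ⟨q, hq, rfl⟩ := hp.exists_eval
  have := congrArg (MvPolynomial.eval (fun i => x i)) hq.sum_X_mul_pderiv
  simp only [map_sum, map_mul, MvPolynomial.eval_X, nsmul_eq_mul, map_natCast] at this
  simp only [pd_eval]
  exact this

theorem IsHHP.setIntegral_sum_pd_mul_pd {k m : ℕ} {v p : EuclideanSpace ℝ (Fin (k + 1)) → ℝ}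
    (hv : ContDiff ℝ 1 v) (hp : IsHHP m p) :
    ∫ x in closedBall 0 1, ∑ i, pd i v x * pd i p x
      = m * ∫ ω, v (ω : EuclideanSpace ℝ (Fin (k + 1))) * p ω
        ∂(volume : Measure (EuclideanSpace ℝ (Fin (k + 1)))).toSphere := by
  have hvc := hv.continuous
  have h1 : ∀ i, ∫ x in closedBall 0 1, pd i (fun y => v y * pd i p y) x
      = ∫ ω, (ω : EuclideanSpace ℝ (Fin (k + 1))) i * (v ω * pd i p ω)
        ∂(volume : Measure (EuclideanSpace ℝ (Fin (k + 1)))).toSphere := fun i =>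
    setIntegral_closedBall_pd (hv.mul (hp.contDiff_pd i)) i
  have h2 : ∀ x, ∑ i, pd i v x * pd i p x = ∑ i, pd i (fun y => v y * pd i p y) x := fun x => by
    simp only [pd_mul hv (hp.contDiff_pd _)]
    rw [Finset.sum_add_distrib, ← Finset.mul_sum]
    obtain ⟨q, -, -, h⟩ := hp
    rw [h x, mul_zero, add_zero]
  simp only [h2]
  rw [integral_finsetSum _ fun i _ => integrableOn_closedBall_of_continuous
    (continuous_pd (hv.mul (hp.contDiff_pd i)) i) _ _]
  simp only [h1]
  rw [← integral_finsetSum _ fun i _ => integrable_toSphere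
    (f := fun ω => ω i * (v ω * pd i p ω)) (by
      have := (hp.contDiff_pd i).continuous
      fun_prop), ← integral_const_mul]
  congr 1
  ext ω
  rw [mul_left_comm, ← hp.sum_mul_pd, Finset.mul_sum]
  exact Finset.sum_congr rfl fun i _ => by ring

theorem IsHHP.integral_mul_eq_zero {k m l : ℕ} {p q : EuclideanSpace ℝ (Fin (k + 1)) → ℝ}
    (hp : IsHHP m p) (hq : IsHHP l q) (hml : m ≠ l) :
    ∫ ω, p (ω : EuclideanSpace ℝ (Fin (k + 1))) * q ω
        ∂(volume : Measure (EuclideanSpace ℝ (Fin (k + 1)))).toSphere = 0 := by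
  have h1 := hq.setIntegral_sum_pd_mul_pd hp.contDiff
  have h2 := hp.setIntegral_sum_pd_mul_pd hq.contDiff
  simp only [mul_comm (pd _ q _), mul_comm (q _)] at h2
  have h3 : ((l : ℝ) - m) * ∫ ω, p (ω : EuclideanSpace ℝ (Fin (k + 1))) * q ω
        ∂(volume : Measure (EuclideanSpace ℝ (Fin (k + 1)))).toSphere = 0 := by
    linear_combination h2 - h1
  exact (mul_eq_zero.1 h3).resolve_left (sub_ne_zero.2 fun h => hml (by exact_mod_cast h.symm))

theorem setIntegral_closedBall_sq_le {k : ℕ} (hk : 1 ≤ k) {v : EuclideanSpace ℝ (Fin (k + 1)) → ℝ}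
    (hv : ContDiff ℝ 1 v) :
    ∫ x in closedBall 0 1, v x ^ 2
      ≤ (∫ ω, v (ω : EuclideanSpace ℝ (Fin (k + 1))) ^ 2
        ∂(volume : Measure (EuclideanSpace ℝ (Fin (k + 1)))).toSphere)
        + ∫ x in closedBall 0 1, ∑ i, pd i v x ^ 2 := by
  have hvc := hv.continuous
  have hpc := continuous_pd hv
  have hv2 : ContDiff ℝ 1 fun x => v x * v x := hv.mul hv
  have h1 : ∀ i, ∫ x in closedBall 0 1, pd i (fun y => v y * v y * y i) x
      = ∫ ω, (ω : EuclideanSpace ℝ (Fin (k + 1))) i * (v ω * v ω * (ω : EuclideanSpace ℝ _) i)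
        ∂(volume : Measure (EuclideanSpace ℝ (Fin (k + 1)))).toSphere := fun i =>
    setIntegral_closedBall_pd (hv2.mul (contDiff_coord i)) i
  have h2 : ∑ i, ∫ x in closedBall 0 1, pd i (fun y => v y * v y * y i) x
      = ∫ ω, v (ω : EuclideanSpace ℝ (Fin (k + 1))) ^ 2
        ∂(volume : Measure (EuclideanSpace ℝ (Fin (k + 1)))).toSphere := by
    simp only [h1]
    rw [← integral_finsetSum _ fun i _ => integrable_toSphere
      (f := fun ω => ω i * (v ω * v ω * ω i)) (by fun_prop)]
    congr 1
    ext ω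
    have hω : ∑ i, (ω : EuclideanSpace ℝ (Fin (k + 1))) i ^ 2 = 1 := by
      rw [← EuclideanSpace.real_norm_sq_eq, norm_eq_of_mem_sphere, one_pow]
    calc _ = ∑ i, v ω ^ 2 * (ω : EuclideanSpace ℝ (Fin (k + 1))) i ^ 2 :=
          Finset.sum_congr rfl fun i _ => by ring
      _ = _ := by rw [← Finset.mul_sum, hω, mul_one]
  rw [← h2, ← integral_finsetSum _ fun i _ => integrableOn_closedBall_of_continuous
    (continuous_pd (hv2.mul (contDiff_coord i)) i) _ _, ← integral_add
    (integrableOn_closedBall_of_continuous (continuous_finsetSum _ fun i _ =>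
      continuous_pd (hv2.mul (contDiff_coord i)) i) _ _)
    (integrableOn_closedBall_of_continuous (by fun_prop) _ _)]
  refine setIntegral_mono_on (integrableOn_closedBall_of_continuous (by fun_prop) _ _)
    (integrableOn_closedBall_of_continuous ((continuous_finsetSum _ fun i _ =>
      continuous_pd (hv2.mul (contDiff_coord i)) i).add (by fun_prop)) _ _)
    isClosed_closedBall.measurableSet fun x hx => ?_
  have hx1 : ∑ i, x i ^ 2 ≤ 1 := by
    rw [← EuclideanSpace.real_norm_sq_eq]
    rw [mem_closedBall_zero_iff] at hx
    exact pow_le_one₀ (norm_nonneg x) hx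
  have hcs := Finset.sum_mul_sq_le_sq_mul_sq Finset.univ (fun i => x i) (fun i => pd i v x)
  have hnn : 0 ≤ ∑ i, pd i v x ^ 2 := Finset.sum_nonneg fun i _ => sq_nonneg _
  have hd : ∑ i, pd i (fun y => v y * v y * y i) x
      = 2 * v x * (∑ i, x i * pd i v x) + (k + 1) * v x ^ 2 := by
    simp only [pd_mul hv2 (contDiff_coord _), pd_mul hv hv, pd_coord]
    rw [Finset.sum_add_distrib, Finset.mul_sum]
    congr 1
    · exact Finset.sum_congr rfl fun i _ => by ring
    · simp only [mul_one]
      rw [Finset.sum_const, Finset.card_univ, Fintype.card_fin, nsmul_eq_mul]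
      push_cast
      ring
  rw [hd]
  have hk' : (1 : ℝ) ≤ k := by exact_mod_cast hk
  have := mul_le_mul_of_nonneg_right hk' (sq_nonneg (v x))
  nlinarith [sq_nonneg (v x + ∑ i, x i * pd i v x), mul_le_mul_of_nonneg_right hx1 hnn]

section SphericalHarmonics

variable {k : ℕ} {v : EuclideanSpace ℝ (Fin (k + 1)) → ℝ}
  {Φ : ℕ → EuclideanSpace ℝ (Fin (k + 1)) → ℝ}

lemma pd_sum {n : ℕ} {Ψ : ℕ → EuclideanSpace ℝ (Fin n) → ℝ} (hΨ : ∀ m, IsHHP m (Ψ m)) (R : ℕ)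
    (i : Fin n) (x : EuclideanSpace ℝ (Fin n)) :
    pd i (fun y => ∑ m ∈ Finset.range R, Ψ m y) x = ∑ m ∈ Finset.range R, pd i (Ψ m) x := by
  unfold pd
  rw [fderiv_fun_sum fun m _ => (hΨ m).contDiff.differentiable one_ne_zero x]
  simp

lemma contDiff_sum_hhp {n : ℕ} {Ψ : ℕ → EuclideanSpace ℝ (Fin n) → ℝ} (hΨ : ∀ m, IsHHP m (Ψ m))
    (R : ℕ) : ContDiff ℝ 1 (fun y => ∑ m ∈ Finset.range R, Ψ m y) :=
  ContDiff.sum fun m _ => (hΨ m).contDiff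

lemma setIntegral_sum_pd_mul_pd_sum (hv : ContDiff ℝ 1 v) (hΦ : ∀ m, IsHHP m (Φ m)) (R : ℕ) :
    ∫ x in closedBall 0 1, ∑ i, pd i v x * pd i (fun y => ∑ m ∈ Finset.range R, Φ m y) x
      = ∑ m ∈ Finset.range R, m * ∫ ω, v (ω : EuclideanSpace ℝ (Fin (k + 1))) * Φ m ω
        ∂(volume : Measure (EuclideanSpace ℝ (Fin (k + 1)))).toSphere := by
  simp only [← (hΦ _).setIntegral_sum_pd_mul_pd hv, pd_sum hΦ, Finset.mul_sum]
  have hc := fun m i => (hΦ m).contDiff_pd i |>.continuous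
  have hpc := continuous_pd hv
  rw [← integral_finsetSum _ fun m _ => integrableOn_closedBall_of_continuous
    (f := fun x => ∑ i, pd i v x * pd i (Φ m) x)
    (continuous_finsetSum _ fun i _ => (hpc i).mul (hc m i)) _ _]
  congr 1
  ext x
  exact Finset.sum_comm

lemma integral_sum_mul_hhp {l : ℕ} {q : EuclideanSpace ℝ (Fin (k + 1)) → ℝ}
    (hΦ : ∀ m, IsHHP m (Φ m)) (hq : IsHHP l q) {R : ℕ} (hl : l ∈ Finset.range R) :
    ∫ ω, (∑ m ∈ Finset.range R, Φ m (ω : EuclideanSpace ℝ (Fin (k + 1)))) * q ω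
        ∂(volume : Measure (EuclideanSpace ℝ (Fin (k + 1)))).toSphere
      = ∫ ω, Φ l (ω : EuclideanSpace ℝ (Fin (k + 1))) * q ω
        ∂(volume : Measure (EuclideanSpace ℝ (Fin (k + 1)))).toSphere := by
  have hc := fun m => (hΦ m).contDiff.continuous
  have hqc := hq.contDiff.continuous
  simp only [Finset.sum_mul]
  rw [integral_finsetSum _ fun m _ => integrable_toSphere (f := fun ω => Φ m ω * q ω)
    ((hc m).mul hqc), Finset.sum_eq_single_of_mem l hl]
  exact fun m _ hm => (hΦ m).integral_mul_eq_zero hq hm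

theorem sum_mul_integral_sq_le (hv : ContDiff ℝ 1 v) (hΦ : ∀ m, IsHHP m (Φ m))
    (h : ∀ m, ∫ ω, v (ω : EuclideanSpace ℝ (Fin (k + 1))) * Φ m ω
        ∂(volume : Measure (EuclideanSpace ℝ (Fin (k + 1)))).toSphere
      = ∫ ω, Φ m (ω : EuclideanSpace ℝ (Fin (k + 1))) ^ 2
        ∂(volume : Measure (EuclideanSpace ℝ (Fin (k + 1)))).toSphere) (R : ℕ) :
    ∑ m ∈ Finset.range R, m * ∫ ω, Φ m (ω : EuclideanSpace ℝ (Fin (k + 1))) ^ 2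
        ∂(volume : Measure (EuclideanSpace ℝ (Fin (k + 1)))).toSphere
      ≤ ∫ x in closedBall 0 1, ∑ i, pd i v x ^ 2 := by
  set w : EuclideanSpace ℝ (Fin (k + 1)) → ℝ := fun y => ∑ m ∈ Finset.range R, Φ m y with hw
  have hwd : ContDiff ℝ 1 w := contDiff_sum_hhp hΦ R
  have hvp := continuous_pd hv
  have hwp := continuous_pd hwd
  have h1 := setIntegral_sum_pd_mul_pd_sum hv hΦ R
  have h2 := setIntegral_sum_pd_mul_pd_sum hwd hΦ R
  rw [← hw] at h1 h2
  have h3 : ∀ m ∈ Finset.range R, (m : ℝ) * ∫ ω, w (ω : EuclideanSpace ℝ (Fin (k + 1))) * Φ m ω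
        ∂(volume : Measure (EuclideanSpace ℝ (Fin (k + 1)))).toSphere
      = m * ∫ ω, Φ m (ω : EuclideanSpace ℝ (Fin (k + 1))) ^ 2
        ∂(volume : Measure (EuclideanSpace ℝ (Fin (k + 1)))).toSphere := fun m hm => by
    rw [hw, integral_sum_mul_hhp hΦ (hΦ m) hm]
    simp only [sq]
  rw [Finset.sum_congr rfl h3] at h2
  simp only [h] at h1
  have h4 : 0 ≤ ∫ x in closedBall 0 1, ∑ i, (pd i v x - pd i w x) ^ 2 :=
    integral_nonneg fun x => Finset.sum_nonneg fun i _ => sq_nonneg _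
  have h5 : ∀ x, ∑ i, (pd i v x - pd i w x) ^ 2 = ∑ i, pd i v x ^ 2
      - 2 * (∑ i, pd i v x * pd i w x) + ∑ i, pd i w x * pd i w x := fun x => by
    rw [Finset.mul_sum, ← Finset.sum_sub_distrib, ← Finset.sum_add_distrib]
    exact Finset.sum_congr rfl fun i _ => by ring
  simp only [h5] at h4
  rw [integral_add (integrableOn_closedBall_of_continuous (by fun_prop) _ _)
    (integrableOn_closedBall_of_continuous (by fun_prop) _ _),
    integral_sub (integrableOn_closedBall_of_continuous (by fun_prop) _ _)
    (integrableOn_closedBall_of_continuous (by fun_prop) _ _), integral_const_mul, h1, h2] at h4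
  linarith

lemma exists_polynomial_near {n : ℕ} {v : EuclideanSpace ℝ (Fin n) → ℝ} (hv : Continuous v) {δ : ℝ}
    (hδ : 0 < δ) : ∃ q : MvPolynomial (Fin n) ℝ, ∀ x ∈ sphere (0 : EuclideanSpace ℝ (Fin n)) 1,
      |v x - MvPolynomial.eval (fun i => x i) q| < δ := by
  set c : Fin n → C(sphere (0 : EuclideanSpace ℝ (Fin n)) 1, ℝ) := fun i =>
    ⟨fun ω => (ω : EuclideanSpace ℝ (Fin n)) i, by fun_prop⟩ with hc
  have he : ∀ (q : MvPolynomial (Fin n) ℝ) ω, MvPolynomial.aeval c q ω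
      = MvPolynomial.eval (fun i => (ω : EuclideanSpace ℝ (Fin n)) i) q := fun q ω => by
    induction q using MvPolynomial.induction_on with
    | C a => simp
    | add p q hp hq => simp [hp, hq]
    | mul_X p i hp =>
      rw [map_mul, ContinuousMap.mul_apply, hp]
      simp [hc]
  obtain ⟨⟨g, q, rfl⟩, hg⟩ :=
    ContinuousMap.exists_mem_subalgebra_near_continuousMap_of_separatesPoints
      (MvPolynomial.aeval (R := ℝ) c).range (fun x y hxy => by
        have : ∃ i, (x : EuclideanSpace ℝ (Fin n)) i ≠ (y : EuclideanSpace ℝ (Fin n)) i := by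
          by_contra! h
          exact hxy (Subtype.ext (PiLp.ext h))
        obtain ⟨i, hi⟩ := this
        exact ⟨c i, ⟨c i, ⟨MvPolynomial.X i, by simp⟩, rfl⟩, hi⟩)
      ⟨fun ω => v ω, hv.comp continuous_subtype_val⟩ δ hδ
  refine ⟨q, fun x hx => ?_⟩
  have := (ContinuousMap.norm_lt_iff _ hδ).1 hg ⟨x, hx⟩
  rw [abs_sub_comm]
  simpa [he] using this

theorem exists_integral_sq_le_sum_add (hv : Continuous v) (hΦ : ∀ m, IsHHP m (Φ m))
    (h : ∀ (m : ℕ) (p : EuclideanSpace ℝ (Fin (k + 1)) → ℝ), IsHHP m p →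
      ∫ ω, v (ω : EuclideanSpace ℝ (Fin (k + 1))) * p ω
        ∂(volume : Measure (EuclideanSpace ℝ (Fin (k + 1)))).toSphere
      = ∫ ω, Φ m (ω : EuclideanSpace ℝ (Fin (k + 1))) * p ω
        ∂(volume : Measure (EuclideanSpace ℝ (Fin (k + 1)))).toSphere) {ε : ℝ} (hε : 0 < ε) :
    ∃ R, ∫ ω, v (ω : EuclideanSpace ℝ (Fin (k + 1))) ^ 2
        ∂(volume : Measure (EuclideanSpace ℝ (Fin (k + 1)))).toSphere
      ≤ ∑ m ∈ Finset.range R, (∫ ω, Φ m (ω : EuclideanSpace ℝ (Fin (k + 1))) ^ 2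
        ∂(volume : Measure (EuclideanSpace ℝ (Fin (k + 1)))).toSphere) + ε := by
  set τ := (volume : Measure (EuclideanSpace ℝ (Fin (k + 1)))).toSphere with hτ
  have hδ : 0 < ε / (τ.real Set.univ + 1) := by positivity
  obtain ⟨q, hq⟩ := exists_polynomial_near hv (Real.sqrt_pos.2 hδ)
  obtain ⟨R, p, hp, hqp⟩ := isSphericalSum_eval k.succ_pos q
  refine ⟨R, ?_⟩
  set P : EuclideanSpace ℝ (Fin (k + 1)) → ℝ := fun y => ∑ m ∈ Finset.range R, p m y with hP
  have hPc : Continuous P := (contDiff_sum_hhp hp R).continuous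
  have hpc := fun m => (hp m).contDiff.continuous
  have hΦc := fun m => (hΦ m).contDiff.continuous
  have h1 : ∫ ω, (v (ω : EuclideanSpace ℝ (Fin (k + 1))) - P ω) ^ 2 ∂τ ≤ ε := by
    have : ∀ ω : sphere (0 : EuclideanSpace ℝ (Fin (k + 1))) 1,
        (v (ω : EuclideanSpace ℝ (Fin (k + 1))) - P ω) ^ 2 ≤ ε / (τ.real Set.univ + 1) :=
      fun ω => by
        have := (hq ω ω.2).le
        rw [show MvPolynomial.eval _ q = P ω from hqp ω ω.2] at this
        rw [← sq_abs, ← Real.sq_sqrt hδ.le]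
        exact pow_le_pow_left₀ (abs_nonneg _) this 2
    refine (integral_mono (integrable_toSphere (f := fun ω => (v ω - P ω) ^ 2) (by fun_prop))
      (integrable_const _) this).trans ?_
    rw [integral_const, smul_eq_mul, mul_div_assoc', div_le_iff₀ (by positivity)]
    nlinarith [measureReal_nonneg (μ := τ) (s := Set.univ)]
  have h2 : ∀ f : EuclideanSpace ℝ (Fin (k + 1)) → ℝ, Continuous f →
      ∫ ω, f (ω : EuclideanSpace ℝ (Fin (k + 1))) * P ω ∂τ
      = ∑ m ∈ Finset.range R, ∫ ω, f (ω : EuclideanSpace ℝ (Fin (k + 1))) * p m ω ∂τ :=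
    fun f hf => by
      simp only [hP, Finset.mul_sum]
      exact integral_finsetSum _ fun m _ => integrable_toSphere (f := fun ω => f ω * p m ω)
        (hf.mul (hpc m))
  have h3 : ∀ m ∈ Finset.range R, ∫ ω, P (ω : EuclideanSpace ℝ (Fin (k + 1))) * p m ω ∂τ
      = ∫ ω, p m (ω : EuclideanSpace ℝ (Fin (k + 1))) ^ 2 ∂τ := fun m hm => by
    rw [hP, hτ, integral_sum_mul_hhp hp (hp m) hm]
    simp only [sq]
  have h4 : ∀ m ∈ Finset.range R, 2 * ∫ ω, v (ω : EuclideanSpace ℝ (Fin (k + 1))) * p m ω ∂τ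
      ≤ (∫ ω, Φ m (ω : EuclideanSpace ℝ (Fin (k + 1))) ^ 2 ∂τ)
        + ∫ ω, p m (ω : EuclideanSpace ℝ (Fin (k + 1))) ^ 2 ∂τ := fun m _ => by
    have hΦm := hΦc m
    have hpm := hpc m
    rw [h m _ (hp m), ← integral_const_mul, ← integral_add
      (integrable_toSphere (f := fun ω => Φ m ω ^ 2) (by fun_prop))
      (integrable_toSphere (f := fun ω => p m ω ^ 2) (by fun_prop))]
    refine integral_mono (integrable_toSphere (f := fun ω => 2 * (Φ m ω * p m ω)) (by fun_prop))
      (integrable_toSphere (f := fun ω => Φ m ω ^ 2 + p m ω ^ 2) (by fun_prop)) fun ω => ?_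
    have := two_mul_le_add_sq (Φ m (ω : EuclideanSpace ℝ (Fin (k + 1)))) (p m ω)
    simp only
    linarith
  have h5 : ∫ ω, (v (ω : EuclideanSpace ℝ (Fin (k + 1))) - P ω) ^ 2 ∂τ
      = (∫ ω, v (ω : EuclideanSpace ℝ (Fin (k + 1))) ^ 2 ∂τ)
        - 2 * (∫ ω, v (ω : EuclideanSpace ℝ (Fin (k + 1))) * P ω ∂τ)
        + ∫ ω, P (ω : EuclideanSpace ℝ (Fin (k + 1))) * P ω ∂τ := by
    rw [← integral_const_mul, ← integral_sub
      (integrable_toSphere (f := fun ω => v ω ^ 2) (by fun_prop))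
      (integrable_toSphere (f := fun ω => 2 * (v ω * P ω)) (by fun_prop)), ← integral_add
      (integrable_toSphere (f := fun ω => v ω ^ 2 - 2 * (v ω * P ω)) (by fun_prop))
      (integrable_toSphere (f := fun ω => P ω * P ω) (by fun_prop))]
    congr 1
    ext ω
    ring
  rw [h2 v hv, h2 P hPc, Finset.sum_congr rfl h3, Finset.mul_sum] at h5
  have h6 := Finset.sum_le_sum h4
  rw [Finset.sum_add_distrib] at h6
  linarith

theorem integral_sq_le_sum_add_div (hv : ContDiff ℝ 1 v) (hΦ : ∀ m, IsHHP m (Φ m))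
    (h : ∀ (m : ℕ) (p : EuclideanSpace ℝ (Fin (k + 1)) → ℝ), IsHHP m p →
      ∫ ω, v (ω : EuclideanSpace ℝ (Fin (k + 1))) * p ω
        ∂(volume : Measure (EuclideanSpace ℝ (Fin (k + 1)))).toSphere
      = ∫ ω, Φ m (ω : EuclideanSpace ℝ (Fin (k + 1))) * p ω
        ∂(volume : Measure (EuclideanSpace ℝ (Fin (k + 1)))).toSphere) (T : ℕ) :
    ∫ ω, v (ω : EuclideanSpace ℝ (Fin (k + 1))) ^ 2
        ∂(volume : Measure (EuclideanSpace ℝ (Fin (k + 1)))).toSphere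
      ≤ ∑ m ∈ Finset.range (T + 1), (∫ ω, Φ m (ω : EuclideanSpace ℝ (Fin (k + 1))) ^ 2
        ∂(volume : Measure (EuclideanSpace ℝ (Fin (k + 1)))).toSphere)
        + (∫ x in closedBall 0 1, ∑ i, pd i v x ^ 2) / (T + 1) := by
  refine le_of_forall_pos_le_add fun ε hε => ?_
  obtain ⟨R, hR⟩ := exists_integral_sq_le_sum_add hv.continuous hΦ h hε
  set S : ℕ → ℝ := fun m => ∫ ω, Φ m (ω : EuclideanSpace ℝ (Fin (k + 1))) ^ 2
        ∂(volume : Measure (EuclideanSpace ℝ (Fin (k + 1)))).toSphere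
  have hS : ∀ m, 0 ≤ S m := fun m => integral_nonneg fun ω => sq_nonneg _
  have hK := sum_mul_integral_sq_le hv hΦ (fun m => by rw [h m _ (hΦ m)]; simp only [sq]) R
  have hT : (0 : ℝ) < T + 1 := by positivity
  have h1 : ∀ m ∈ Finset.range R,
      S m ≤ (if m ∈ Finset.range (T + 1) then S m else 0) + m * S m / (T + 1) := fun m _ => by
    split_ifs with hm
    · have : 0 ≤ m * S m / (T + 1) := div_nonneg (mul_nonneg (Nat.cast_nonneg m) (hS m)) hT.le
      linarith
    · rw [zero_add, le_div_iff₀ hT, mul_comm]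
      refine mul_le_mul_of_nonneg_right ?_ (hS m)
      have : T + 1 ≤ m := by simpa using hm
      exact_mod_cast this
  have h2 := Finset.sum_le_sum h1
  rw [Finset.sum_add_distrib, ← Finset.sum_filter, ← Finset.sum_div] at h2
  have h3 : ∑ m ∈ Finset.range R with m ∈ Finset.range (T + 1), S m
      ≤ ∑ m ∈ Finset.range (T + 1), S m :=
    Finset.sum_le_sum_of_subset_of_nonneg (fun m hm => (Finset.mem_filter.1 hm).2)
      fun m _ _ => hS m
  have h4 := div_le_div_of_nonneg_right hK hT.le
  linarith

end SphericalHarmonics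

lemma exists_contDiff_eqOn_ball {n : ℕ} {u : EuclideanSpace ℝ (Fin n) → ℝ} {M : ℝ} (hM : 2 ≤ M)
    (hu : ContDiffOn ℝ 1 u (closedBall 0 M)) :
    ∃ v : EuclideanSpace ℝ (Fin n) → ℝ, ContDiff ℝ 1 v ∧ Set.EqOn v u (ball 0 (3 / 2)) := by
  let χ : ContDiffBump (0 : EuclideanSpace ℝ (Fin n)) := ⟨3 / 2, 7 / 4, by norm_num, by norm_num⟩
  refine ⟨fun x => χ x * u x, contDiff_iff_contDiffAt.2 fun x => ?_, fun x hx => ?_⟩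
  · by_cases hx : x ∈ ball (0 : EuclideanSpace ℝ (Fin n)) 2
    · have : closedBall (0 : EuclideanSpace ℝ (Fin n)) M ∈ nhds x :=
        Filter.mem_of_superset (isOpen_ball.mem_nhds hx)
          (ball_subset_closedBall.trans (closedBall_subset_closedBall hM))
      exact χ.contDiff.contDiffAt.mul (hu.contDiffAt this)
    · have hx' : x ∉ tsupport χ := by
        rw [χ.tsupport_eq]
        intro h
        have h2 : dist x 0 ≤ 7 / 4 := h
        exact hx (mem_ball.2 (by linarith))
      refine (contDiffAt_const (c := (0 : ℝ))).congr_of_eventuallyEq ?_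
      filter_upwards [notMem_tsupport_iff_eventuallyEq.1 hx'] with y hy
      simp [hy]
  · have : χ x = 1 := χ.one_of_mem_closedBall (ball_subset_closedBall hx)
    simp [this]

open scoped Pointwise in
lemma setIntegral_sphere_eq_pow_mul {k : ℕ} {r : ℝ} (hr : 0 < r)
    (f : EuclideanSpace ℝ (Fin (k + 1)) → ℝ) :
    ∫ x in sphere (0 : EuclideanSpace ℝ (Fin (k + 1))) r, f x ∂μH[(k : ℝ)]
      = r ^ k * ∫ x in sphere (0 : EuclideanSpace ℝ (Fin (k + 1))) 1, f (r • x) ∂μH[(k : ℝ)] := by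
  have hemb : MeasurableEmbedding fun x : EuclideanSpace ℝ (Fin (k + 1)) => r • x :=
    measurableEmbedding_const_smul₀ hr.ne'
  have hm : (μH[(k : ℝ)] : Measure (EuclideanSpace ℝ (Fin (k + 1)))).restrict (sphere 0 r)
      = ENNReal.ofReal (r ^ k) • ((μH[(k : ℝ)] : Measure (EuclideanSpace ℝ (Fin (k + 1)))).restrict
        (sphere 0 1)).map (fun x => r • x) := by
    ext s hs
    rw [Measure.restrict_apply hs, Measure.smul_apply, hemb.map_apply,
      Measure.restrict_apply (hemb.measurable hs)]
    have : s ∩ sphere 0 r = r • ((fun x => r • x) ⁻¹' s ∩ sphere 0 1) := by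
      ext x
      rw [Set.mem_smul_set_iff_inv_smul_mem₀ hr.ne']
      simp only [Set.mem_inter_iff, Set.mem_preimage, smul_smul, mul_inv_cancel₀ hr.ne', one_smul,
        mem_sphere_zero_iff_norm, norm_smul, norm_inv, Real.norm_eq_abs, abs_of_pos hr]
      rw [inv_mul_eq_one₀ hr.ne', eq_comm (a := r)]
    rw [this, Measure.hausdorffMeasure_smul₀ (Nat.cast_nonneg k) hr.ne', NNReal.rpow_natCast,
      ENNReal.smul_def, smul_eq_mul, smul_eq_mul]
    congr 1
    rw [ENNReal.ofReal, ENNReal.coe_inj]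
    ext
    simp [abs_of_pos hr, hr.le]
  rw [hm, integral_smul_measure, hemb.integral_map, ENNReal.toReal_ofReal (by positivity),
    smul_eq_mul]

open scoped Pointwise in
lemma hausdorffMeasure_sphere_lt_top {k : ℕ} {r : ℝ} (hr : 0 < r) :
    μH[(k : ℝ)] (sphere (0 : EuclideanSpace ℝ (Fin (k + 1))) r) < ⊤ := by
  have : sphere (0 : EuclideanSpace ℝ (Fin (k + 1))) r =
      r • sphere (0 : EuclideanSpace ℝ (Fin (k + 1))) 1 := by
    rw [_root_.smul_sphere _ _ zero_le_one]
    simp [abs_of_pos hr]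
  rw [this, Measure.hausdorffMeasure_smul₀ (Nat.cast_nonneg k) hr.ne', ENNReal.smul_def,
    smul_eq_mul]
  exact ENNReal.mul_lt_top ENNReal.coe_lt_top (hausdorffMeasure_sphere_ne_top k).lt_top

lemma integrableOn_sphere_of_continuousOn {k : ℕ} {r : ℝ} (hr : 0 < r)
    {f : EuclideanSpace ℝ (Fin (k + 1)) → ℝ} (hf : ContinuousOn f (sphere 0 r)) :
    IntegrableOn f (sphere 0 r) μH[(k : ℝ)] := by
  obtain ⟨C, hC⟩ := (isCompact_sphere (0 : EuclideanSpace ℝ (Fin (k + 1))) r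
    ).exists_bound_of_continuousOn hf
  exact IntegrableOn.of_bound (hausdorffMeasure_sphere_lt_top hr)
    (hf.aestronglyMeasurable isClosed_sphere.measurableSet) C
    ((ae_restrict_iff' isClosed_sphere.measurableSet).2 (Filter.Eventually.of_forall hC))

theorem energy_le_of_freq_le {k : ℕ} (hk : 1 ≤ k) {lam N M r c : ℝ} (hlam : 1 ≤ lam)
    (hN : 0 < N) (hr : 0 < r) (hr1 : r ≤ 1) (hM : 2 ≤ M)
    (hc : ∀ f : EuclideanSpace ℝ (Fin (k + 1)) → ℝ,
      ∫ x in sphere (0 : EuclideanSpace ℝ (Fin (k + 1))) 1, f x ∂μH[(k : ℝ)]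
        = c * ∫ ω, f (ω : EuclideanSpace ℝ (Fin (k + 1)))
          ∂(volume : Measure (EuclideanSpace ℝ (Fin (k + 1)))).toSphere) (hc0 : 0 < c)
    {A : EuclideanSpace ℝ (Fin (k + 1)) → Matrix (Fin (k + 1)) (Fin (k + 1)) ℝ}
    {u v : EuclideanSpace ℝ (Fin (k + 1)) → ℝ}
    (hA : ∀ i j, ContinuousOn (fun x => A x i j) (closedBall 0 M))
    (hell : UnifElliptic A lam (closedBall 0 M)) (hv : ContDiff ℝ 1 v)
    (hvu : Set.EqOn v u (ball 0 (3 / 2))) (hfreq : freq A u r ≤ N)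
    (hH : ∫ ω, v (r • (ω : EuclideanSpace ℝ (Fin (k + 1)))) ^ 2
      ∂(volume : Measure (EuclideanSpace ℝ (Fin (k + 1)))).toSphere ≠ 0) :
    ∫ x in closedBall 0 r, ∑ i, pd i v x ^ 2
      ≤ lam ^ 2 * N * c * ∫ ω, v (r • (ω : EuclideanSpace ℝ (Fin (k + 1)))) ^ 2
        ∂(volume : Measure (EuclideanSpace ℝ (Fin (k + 1)))).toSphere := by
  have hlam0 : 0 < lam := by linarith
  have hvc := hv.continuous
  have hpc := continuous_pd hv
  have hsub : closedBall (0 : EuclideanSpace ℝ (Fin (k + 1))) r ⊆ ball 0 (3 / 2) :=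
    closedBall_subset_ball (by linarith)
  have hsubM : closedBall (0 : EuclideanSpace ℝ (Fin (k + 1))) r ⊆ closedBall 0 M :=
    closedBall_subset_closedBall (by linarith)
  have hpd : ∀ x ∈ closedBall (0 : EuclideanSpace ℝ (Fin (k + 1))) r, ∀ i, pd i u x = pd i v x :=
    fun x hx i => by
      have : v =ᶠ[nhds x] u := hvu.eventuallyEq_of_mem (isOpen_ball.mem_nhds (hsub hx))
      unfold pd
      rw [this.fderiv_eq]
  set H := ∫ x in sphere (0 : EuclideanSpace ℝ (Fin (k + 1))) r, v x ^ 2 ∂μH[(k : ℝ)] with hHdef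
  set Hτ := ∫ ω, v (r • (ω : EuclideanSpace ℝ (Fin (k + 1)))) ^ 2
      ∂(volume : Measure (EuclideanSpace ℝ (Fin (k + 1)))).toSphere
  have hHτ : H = r ^ k * (c * Hτ) := by
    rw [hHdef, setIntegral_sphere_eq_pow_mul hr, hc]
  have hHτpos : 0 < Hτ := lt_of_le_of_ne (integral_nonneg fun ω => sq_nonneg _) hH.symm
  have hHpos : 0 < H := by rw [hHτ]; positivity
  have hHint : IntegrableOn (fun x => v x ^ 2) (sphere 0 r) μH[(k : ℝ)] :=
    integrableOn_sphere_of_continuousOn hr (by fun_prop)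
  set D := ∫ x in closedBall (0 : EuclideanSpace ℝ (Fin (k + 1))) r,
        ∑ i, ∑ j, A x i j * pd j u x * pd i u x with hD
  set h := ∫ x in sphere (0 : EuclideanSpace ℝ (Fin (k + 1))) r,
        ((∑ i, ∑ j, A x i j * x j * x i) / ‖x‖ ^ 2) * u x ^ 2 ∂μH[(k : ℝ)] with hh
  have hquot : ∀ x ∈ sphere (0 : EuclideanSpace ℝ (Fin (k + 1))) r,
      lam⁻¹ ≤ (∑ i, ∑ j, A x i j * x j * x i) / ‖x‖ ^ 2 ∧
      (∑ i, ∑ j, A x i j * x j * x i) / ‖x‖ ^ 2 ≤ lam := fun x hx => by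
    have he := hell x (hsubM (sphere_subset_closedBall hx)) (fun i => x i)
    have hx0 : 0 < ‖x‖ ^ 2 := by
      rw [mem_sphere_zero_iff_norm.1 hx]; positivity
    simp only [← EuclideanSpace.real_norm_sq_eq] at he
    rw [le_div_iff₀ hx0, div_le_iff₀ hx0]
    simpa only [mul_right_comm] using he
  have hcongr : h = ∫ x in sphere (0 : EuclideanSpace ℝ (Fin (k + 1))) r,
        ((∑ i, ∑ j, A x i j * x j * x i) / ‖x‖ ^ 2) * v x ^ 2 ∂μH[(k : ℝ)] :=
    setIntegral_congr_fun isClosed_sphere.measurableSet fun x hx => by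
      simp only [hvu (hsub (sphere_subset_closedBall hx))]
  have hA' : ∀ i j, ContinuousOn (fun x => A x i j) (closedBall 0 r) := fun i j =>
    (hA i j).mono hsubM
  have hhint : IntegrableOn (fun x => ((∑ i, ∑ j, A x i j * x j * x i) / ‖x‖ ^ 2) * v x ^ 2)
      (sphere 0 r) μH[(k : ℝ)] := by
    refine integrableOn_sphere_of_continuousOn hr (ContinuousOn.mul (ContinuousOn.div
      (continuousOn_finsetSum _ fun i _ => continuousOn_finsetSum _ fun j _ =>
        (((hA' i j).mono sphere_subset_closedBall).mul (by fun_prop)).mul (by fun_prop))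
      (by fun_prop) fun x hx => ?_) (by fun_prop))
    rw [mem_sphere_zero_iff_norm.1 hx]
    positivity
  have hh_le : h ≤ lam * H := by
    rw [hcongr, hHdef, ← integral_const_mul]
    exact setIntegral_mono_on hhint (hHint.const_mul _) isClosed_sphere.measurableSet
      fun x hx => mul_le_mul_of_nonneg_right (hquot x hx).2 (sq_nonneg _)
  have hle_h : lam⁻¹ * H ≤ h := by
    rw [hcongr, hHdef, ← integral_const_mul]
    exact setIntegral_mono_on (hHint.const_mul _) hhint isClosed_sphere.measurableSet
      fun x hx => mul_le_mul_of_nonneg_right (hquot x hx).1 (sq_nonneg _)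
  have hhpos : 0 < h := lt_of_lt_of_le (by positivity) hle_h
  set K := ∫ x in closedBall (0 : EuclideanSpace ℝ (Fin (k + 1))) r, ∑ i, pd i v x ^ 2 with hK
  have hK_le : lam⁻¹ * K ≤ D := by
    have : D = ∫ x in closedBall (0 : EuclideanSpace ℝ (Fin (k + 1))) r,
        ∑ i, ∑ j, A x i j * pd j v x * pd i v x :=
      setIntegral_congr_fun isClosed_closedBall.measurableSet fun x hx => by
        simp only [hpd x hx]
    rw [this, hK, ← integral_const_mul]
    refine setIntegral_mono_on ((integrableOn_closedBall_of_continuous (by fun_prop) _ _).const_mul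
      _) (ContinuousOn.integrableOn_compact (isCompact_closedBall _ _)
      (continuousOn_finsetSum _ fun i _ => continuousOn_finsetSum _ fun j _ =>
        ((hA' i j).mul (hpc j).continuousOn).mul (hpc i).continuousOn))
      isClosed_closedBall.measurableSet fun x hx => ?_
    have he := (hell x (hsubM hx) (fun i => pd i v x)).1
    simpa only [mul_right_comm] using he
  have hfr : r * D ≤ N * h := by
    have hcast : ((k + 1 : ℕ) : ℝ) - 1 = k := by push_cast; ring
    unfold freq at hfreq
    rw [hcast, ← hD, ← hh] at hfreq
    have hp : 0 < r ^ (1 - ((k + 1 : ℕ) : ℝ)) := Real.rpow_pos_of_pos hr _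
    rw [div_le_iff₀ (mul_pos hp hhpos)] at hfreq
    refine le_of_mul_le_mul_left ?_ hp
    linarith
  have h1 : r * K ≤ lam ^ 2 * N * H := by
    have e1 : r * (lam⁻¹ * K) ≤ N * (lam * H) :=
      (mul_le_mul_of_nonneg_left hK_le hr.le).trans (hfr.trans (mul_le_mul_of_nonneg_left hh_le
        hN.le))
    have e2 := mul_le_mul_of_nonneg_left e1 hlam0.le
    have e3 : lam * (r * (lam⁻¹ * K)) = r * K := by field_simp
    rw [e3] at e2
    linarith
  have h2 : r ^ k ≤ r := by simpa using pow_le_pow_of_le_one hr.le hr1 hk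
  have h3 : lam ^ 2 * N * H ≤ r * (lam ^ 2 * N * c * Hτ) := by
    rw [hHτ]
    have := mul_le_mul_of_nonneg_right h2 (by positivity : 0 ≤ lam ^ 2 * N * c * Hτ)
    linarith
  exact le_of_mul_le_mul_left (h1.trans h3) hr

lemma fderiv_eq_zero_of_pd {n : ℕ} {v : EuclideanSpace ℝ (Fin n) → ℝ}
    {x : EuclideanSpace ℝ (Fin n)} (h : ∀ i, pd i v x = 0) : fderiv ℝ v x = 0 := by
  ext y
  have hy : y = ∑ i, y i • EuclideanSpace.single i (1 : ℝ) := by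
    conv_lhs => rw [← (EuclideanSpace.basisFun (Fin n) ℝ).sum_repr y]
    simp
  rw [hy, map_sum]
  refine Finset.sum_eq_zero fun i _ => ?_
  rw [map_smul, show fderiv ℝ v x (EuclideanSpace.single i 1) = 0 from h i, smul_zero]

lemma eq_zero_of_integral_toSphere_eq_zero {k : ℕ} {f : EuclideanSpace ℝ (Fin (k + 1)) → ℝ}
    (hf : Continuous f) (h : ∫ ω, f (ω : EuclideanSpace ℝ (Fin (k + 1))) ^ 2
      ∂(volume : Measure (EuclideanSpace ℝ (Fin (k + 1)))).toSphere = 0)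
    (ω : sphere (0 : EuclideanSpace ℝ (Fin (k + 1))) 1) : f ω = 0 := by
  have h1 := (integral_eq_zero_iff_of_nonneg (fun ω => sq_nonneg _)
    (integrable_toSphere (f := fun ω => f ω ^ 2) (by fun_prop))).1 h
  have h2 := Continuous.ae_eq_iff_eq (f := fun ω : sphere (0 : EuclideanSpace ℝ (Fin (k + 1))) 1 =>
    f (ω : EuclideanSpace ℝ (Fin (k + 1))) ^ 2) (g := 0) _
    (by fun_prop) continuous_zero |>.1 h1
  exact pow_eq_zero_iff two_ne_zero |>.1 (congrFun h2 ω)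

theorem eq_zero_of_energy_le {k : ℕ} {v : EuclideanSpace ℝ (Fin (k + 1)) → ℝ}
    (hv : ContDiff ℝ 1 v) {L : ℝ}
    (h : ∀ r, 0 < r → r ≤ 1 → ∫ ω, v (r • (ω : EuclideanSpace ℝ (Fin (k + 1)))) ^ 2
        ∂(volume : Measure (EuclideanSpace ℝ (Fin (k + 1)))).toSphere ≠ 0 →
      ∫ x in closedBall 0 r, ∑ i, pd i v x ^ 2
        ≤ L * ∫ ω, v (r • (ω : EuclideanSpace ℝ (Fin (k + 1)))) ^ 2
          ∂(volume : Measure (EuclideanSpace ℝ (Fin (k + 1)))).toSphere)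
    (h0 : ∫ ω, v (ω : EuclideanSpace ℝ (Fin (k + 1))) ^ 2
        ∂(volume : Measure (EuclideanSpace ℝ (Fin (k + 1)))).toSphere = 0)
    {x : EuclideanSpace ℝ (Fin (k + 1))} (hx : x ∈ closedBall 0 1) : v x = 0 := by
  have hvc := hv.continuous
  have hpc := continuous_pd hv
  set H : ℝ → ℝ := fun r => ∫ ω, v (r • (ω : EuclideanSpace ℝ (Fin (k + 1)))) ^ 2
        ∂(volume : Measure (EuclideanSpace ℝ (Fin (k + 1)))).toSphere with hH
  have hHc : Continuous H := continuous_integral_toSphere_smul (F := fun r ω => v (r • ω) ^ 2) (by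
    unfold Function.uncurry
    fun_prop)
  have hzero : ∀ r, H r = 0 → ∀ ω : sphere (0 : EuclideanSpace ℝ (Fin (k + 1))) 1,
      v (r • (ω : EuclideanSpace ℝ (Fin (k + 1)))) = 0 := fun r hr ω =>
    eq_zero_of_integral_toSphere_eq_zero (f := fun ω => v (r • ω)) (by fun_prop) hr ω
  have hall : ∀ r ∈ Set.Icc (0 : ℝ) 1, H r = 0 := by
    by_contra! hne
    set Z : Set ℝ := {r | r ∈ Set.Icc (0 : ℝ) 1 ∧ H r ≠ 0} with hZ
    have hZne : Z.Nonempty := hne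
    have hZb : BddAbove Z := ⟨1, fun r hr => hr.1.2⟩
    set s := sSup Z with hs
    have hs1 : s ≤ 1 := csSup_le hZne fun r hr => hr.1.2
    have hs0 : 0 ≤ s := by
      obtain ⟨r, hr⟩ := hZne
      exact hr.1.1.trans (le_csSup hZb hr)
    have hH1 : H 1 = 0 := by simpa [hH] using h0
    have hHs : H s = 0 := by
      by_contra hne
      have hlt : s < 1 := lt_of_le_of_ne hs1 fun e => hne (by rw [e, hH1])
      have hev : ∀ᶠ r in nhdsWithin s (Set.Ioi s), H r ≠ 0 ∧ r < 1 :=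
        nhdsWithin_le_nhds ((hHc.continuousAt.eventually_ne hne).and (gt_mem_nhds hlt))
      obtain ⟨r, ⟨hr1, hr2⟩, hr3⟩ := (hev.and self_mem_nhdsWithin).exists
      have hr3' : s < r := hr3
      exact absurd (le_csSup hZb (show r ∈ Z from ⟨⟨hs0.trans hr3'.le, hr2.le⟩, hr1⟩))
        (not_le.2 hr3')
    have hlt : ∀ r ∈ Z, r < s := fun r hr =>
      lt_of_le_of_ne (le_csSup hZb hr) fun e => hr.2 (by rw [e, hHs])
    have hspos : 0 < s := by
      obtain ⟨r, hr⟩ := hZne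
      exact hr.1.1.trans_lt (hlt r hr)
    have hE : ∀ ρ < s, 0 < ρ → ∫ x in closedBall (0 : EuclideanSpace ℝ (Fin (k + 1))) ρ,
        ∑ i, pd i v x ^ 2 ≤ 0 := fun ρ hρ hρ0 => by
      refine le_of_forall_pos_le_add fun ε hε => ?_
      have hcont : ContinuousAt (fun r => L * H r) s := by fun_prop
      have hev : ∀ᶠ r in nhds s, L * H r < ε :=
        hcont.eventually (gt_mem_nhds (by simpa [hHs] using hε))
      obtain ⟨δ, hδ, hδs⟩ := Metric.eventually_nhds_iff.1 hev
      obtain ⟨r, hrZ, hr⟩ := exists_lt_of_lt_csSup hZne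
        (max_lt hρ (sub_lt_self s hδ) : max ρ (s - δ) < sSup Z)
      have hr1 : ρ < r := (le_max_left _ _).trans_lt hr
      have hr2 : s - δ < r := (le_max_right _ _).trans_lt hr
      have hrs := hlt r hrZ
      have h1 := h r (hρ0.trans hr1) hrZ.1.2 hrZ.2
      have h2 : L * H r < ε := hδs (by rw [Real.dist_eq, abs_lt]; constructor <;> linarith)
      have h3 : ∫ x in closedBall (0 : EuclideanSpace ℝ (Fin (k + 1))) ρ, ∑ i, pd i v x ^ 2
          ≤ ∫ x in closedBall (0 : EuclideanSpace ℝ (Fin (k + 1))) r, ∑ i, pd i v x ^ 2 :=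
        setIntegral_mono_set (integrableOn_closedBall_of_continuous (by fun_prop) _ _)
          (Filter.Eventually.of_forall fun x => Finset.sum_nonneg fun i _ => sq_nonneg _)
          (Filter.Eventually.of_forall (closedBall_subset_closedBall hr1.le))
      have h1' : ∫ x in closedBall (0 : EuclideanSpace ℝ (Fin (k + 1))) r, ∑ i, pd i v x ^ 2
        ≤ L * H r := h1
      linarith
    have hpd : ∀ x ∈ ball (0 : EuclideanSpace ℝ (Fin (k + 1))) s, fderiv ℝ v x = 0 := fun x hx => by
      rw [mem_ball_zero_iff] at hx
      obtain ⟨ρ, hxρ, hρs⟩ := exists_between hx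
      have hρ0 : 0 < ρ := (norm_nonneg x).trans_lt hxρ
      have hnn : ∀ x, 0 ≤ ∑ i, pd i v x ^ 2 := fun x => Finset.sum_nonneg fun i _ => sq_nonneg _
      have he := (hE ρ hρs hρ0).antisymm (integral_nonneg hnn)
      have hball : ∫ x in ball (0 : EuclideanSpace ℝ (Fin (k + 1))) ρ, ∑ i, pd i v x ^ 2 = 0 :=
        le_antisymm ((setIntegral_mono_set (integrableOn_closedBall_of_continuous (by fun_prop) _ _)
          (Filter.Eventually.of_forall hnn)
          (Filter.Eventually.of_forall ball_subset_closedBall)).trans he.le) (integral_nonneg hnn)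
      have hae := (setIntegral_eq_zero_iff_of_nonneg_ae (Filter.Eventually.of_forall hnn)
        ((integrableOn_closedBall_of_continuous (by fun_prop) _ _).mono_set
          ball_subset_closedBall)).1 hball
      have heq := Measure.eqOn_open_of_ae_eq hae isOpen_ball
        (by fun_prop) continuousOn_const
      have := heq (mem_ball_zero_iff.2 hxρ)
      refine fderiv_eq_zero_of_pd fun i => ?_
      exact pow_eq_zero_iff two_ne_zero |>.1
        ((Finset.sum_eq_zero_iff_of_nonneg fun i _ => sq_nonneg _).1 this i (Finset.mem_univ i))
    have hconst : ∀ x ∈ ball (0 : EuclideanSpace ℝ (Fin (k + 1))) s, v x = v 0 := fun x hx =>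
      isOpen_ball.is_const_of_fderiv_eq_zero (convex_ball _ _).isPreconnected
        (hv.differentiable one_ne_zero).differentiableOn hpd hx (mem_ball_self hspos)
    have hclosed : closedBall (0 : EuclideanSpace ℝ (Fin (k + 1))) s ⊆ {x | v x = v 0} := by
      rw [← closure_ball _ hspos.ne']
      exact closure_minimal hconst (isClosed_eq hvc continuous_const)
    obtain ⟨r, hrZ⟩ := hZne
    refine hrZ.2 ?_
    have : ∀ ω : sphere (0 : EuclideanSpace ℝ (Fin (k + 1))) 1,
        v (r • (ω : EuclideanSpace ℝ (Fin (k + 1)))) = 0 := fun ω => by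
      have hn : ∀ t, 0 ≤ t → t ≤ s → t • (ω : EuclideanSpace ℝ (Fin (k + 1))) ∈
          closedBall (0 : EuclideanSpace ℝ (Fin (k + 1))) s := fun t ht hts => by
        rw [mem_closedBall_zero_iff, norm_smul, norm_eq_of_mem_sphere, mul_one, Real.norm_eq_abs,
          abs_of_nonneg ht]
        exact hts
      have e1 : v (r • (ω : EuclideanSpace ℝ (Fin (k + 1)))) = v 0 :=
        hclosed (hn r hrZ.1.1 (hlt r hrZ).le)
      have e2 : v (s • (ω : EuclideanSpace ℝ (Fin (k + 1)))) = v 0 := hclosed (hn s hs0 le_rfl)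
      rw [e1, ← e2, hzero s hHs]
    simp [hH, this]
  rw [mem_closedBall_zero_iff] at hx
  have hr := hzero ‖x‖ (hall _ ⟨norm_nonneg x, hx⟩)
  rcases eq_or_ne x 0 with rfl | hx0
  · obtain ⟨ω, hω⟩ := NormedSpace.sphere_nonempty (E := EuclideanSpace ℝ (Fin (k + 1)))
      (x := 0) |>.2 zero_le_one
    simpa using hr ⟨ω, hω⟩
  · have hx1 : ‖x‖ ≠ 0 := norm_ne_zero_iff.2 hx0
    have := hr ⟨‖x‖⁻¹ • x, by simp [norm_smul, hx1]⟩
    simpa [smul_smul, hx1] using this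

/-- Theorem 1.10 of the paper: the `L²` version of Nadirashvili's conjecture for `C¹`
(Lipschitz) coefficients.  The orthogonal projection `P_m (u|_{∂B(0,1)})` onto the space of
restrictions of degree-`m` homogeneous harmonic polynomials is encoded by a family
`Φ m` of homogeneous harmonic polynomials of degree `m` such that `u - Φ m` is orthogonal in
`L²(∂B(0,1))` to every homogeneous harmonic polynomial of degree `m`; then
`‖P_m(u|_{∂B(0,1)})‖²_{L²} = ∫_{∂B(0,1)} (Φ m)²`. -/
theorem stmt_4 (n : ℕ) (hn : 2 ≤ n) (lam : ℝ) (hlam : 1 ≤ lam) (N : ℝ) (hN : 0 < N) :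
    ∃ M₀ : ℝ, 0 < M₀ ∧ ∀ M : ℝ, M₀ ≤ M →
      ∃ (T : ℕ) (C : ℝ), 0 < C ∧
        ∀ (A : EuclideanSpace ℝ (Fin n) → Matrix (Fin n) (Fin n) ℝ)
          (u : EuclideanSpace ℝ (Fin n) → ℝ),
          (∀ i j, ContDiffOn ℝ 1 (fun x => A x i j)
            (closedBall (0 : EuclideanSpace ℝ (Fin n)) M)) →
          (∀ i j, LipschitzOnWith (Real.toNNReal lam) (fun x => A x i j)
            (closedBall (0 : EuclideanSpace ℝ (Fin n)) M)) →
          UnifElliptic A lam (closedBall (0 : EuclideanSpace ℝ (Fin n)) M) →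
          A 0 = 1 →
          ContDiffOn ℝ 1 u (closedBall (0 : EuclideanSpace ℝ (Fin n)) M) →
          SolvesDiv A u (closedBall (0 : EuclideanSpace ℝ (Fin n)) M) →
          (∃ x ∈ closedBall (0 : EuclideanSpace ℝ (Fin n)) M, u x ≠ 0) →
          (∀ r : ℝ, 0 < r → r < M → freq A u r ≤ N) →
          ∀ Φ : ℕ → EuclideanSpace ℝ (Fin n) → ℝ,
            (∀ m, IsHHP m (Φ m)) →
            (∀ m, ∀ p : EuclideanSpace ℝ (Fin n) → ℝ, IsHHP m p →
              (∫ x in sphere (0 : EuclideanSpace ℝ (Fin n)) 1,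
                (u x - Φ m x) * p x ∂ μH[(n : ℝ) - 1]) = 0) →
            (∫ x in closedBall (0 : EuclideanSpace ℝ (Fin n)) (1 / 4), u x ^ 2)
              ≤ C * ∑ m ∈ Finset.range (T + 1),
                  ∫ x in sphere (0 : EuclideanSpace ℝ (Fin n)) 1,
                    Φ m x ^ 2 ∂ μH[(n : ℝ) - 1] := by
  obtain ⟨k, rfl⟩ : ∃ k, n = k + 1 := ⟨n - 1, by omega⟩
  have hk : 1 ≤ k := by omega
  obtain ⟨c, hc0, hc⟩ := exists_setIntegral_sphere_eq k
  have hcast : ((k + 1 : ℕ) : ℝ) - 1 = k := by push_cast; ring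
  have hlam0 : 0 < lam := by linarith
  rw [hcast]
  set L := lam ^ 2 * N * c with hL
  have hL0 : 0 < L := by positivity
  refine ⟨2, two_pos, fun M hM => ⟨⌈2 * L⌉₊, 2 * (1 + L) / c, by positivity, ?_⟩⟩
  intro A u hA _ hell _ hu _ _ hfreq Φ hΦ horth
  obtain ⟨v, hv, hvu⟩ := exists_contDiff_eqOn_ball hM hu
  have hvc := hv.continuous
  have hpc := continuous_pd hv
  have horth' : ∀ (m : ℕ) (p : EuclideanSpace ℝ (Fin (k + 1)) → ℝ), IsHHP m p →
      ∫ ω, v (ω : EuclideanSpace ℝ (Fin (k + 1))) * p ω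
        ∂(volume : Measure (EuclideanSpace ℝ (Fin (k + 1)))).toSphere
      = ∫ ω, Φ m (ω : EuclideanSpace ℝ (Fin (k + 1))) * p ω
        ∂(volume : Measure (EuclideanSpace ℝ (Fin (k + 1)))).toSphere := fun m p hp => by
    have hpcont := (IsHHP.contDiff hp).continuous
    have hΦcont := (IsHHP.contDiff (hΦ m)).continuous
    have h1 := horth m p hp
    rw [hc, mul_eq_zero, or_iff_right hc0.ne'] at h1
    rw [← sub_eq_zero, ← integral_sub (integrable_toSphere (f := fun x => v x * p x) (by fun_prop))
      (integrable_toSphere (f := fun x => Φ m x * p x) (by fun_prop)), ← h1]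
    refine integral_congr_ae (Filter.Eventually.of_forall fun ω => ?_)
    have : v ω = u ω := hvu (mem_ball_zero_iff.2 (by rw [norm_eq_of_mem_sphere]; norm_num))
    simp only [this, sub_mul]
  have henergy : ∀ r, 0 < r → r ≤ 1 →
      ∫ ω, v (r • (ω : EuclideanSpace ℝ (Fin (k + 1)))) ^ 2
        ∂(volume : Measure (EuclideanSpace ℝ (Fin (k + 1)))).toSphere ≠ 0 →
      ∫ x in closedBall 0 r, ∑ i, pd i v x ^ 2
        ≤ L * ∫ ω, v (r • (ω : EuclideanSpace ℝ (Fin (k + 1)))) ^ 2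
          ∂(volume : Measure (EuclideanSpace ℝ (Fin (k + 1)))).toSphere := fun r hr hr1 hH =>
    energy_le_of_freq_le hk hlam hN hr hr1 hM hc hc0 (fun i j => (hA i j).continuousOn) hell hv hvu
      (hfreq r hr (by linarith)) hH
  have hlhs : ∫ x in closedBall (0 : EuclideanSpace ℝ (Fin (k + 1))) (1 / 4), u x ^ 2
      = ∫ x in closedBall (0 : EuclideanSpace ℝ (Fin (k + 1))) (1 / 4), v x ^ 2 :=
    setIntegral_congr_fun isClosed_closedBall.measurableSet fun x hx => by
      simp only [hvu (closedBall_subset_ball (by norm_num) hx)]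
  simp only [hc]
  rw [hlhs, ← Finset.mul_sum, ← mul_assoc, div_mul_cancel₀ _ hc0.ne']
  set S := ∑ m ∈ Finset.range (⌈2 * L⌉₊ + 1), ∫ ω, Φ m (ω : EuclideanSpace ℝ (Fin (k + 1))) ^ 2
    ∂(volume : Measure (EuclideanSpace ℝ (Fin (k + 1)))).toSphere
  have hS0 : 0 ≤ S := Finset.sum_nonneg fun m _ => integral_nonneg fun ω => sq_nonneg _
  by_cases h0 : ∫ ω, v (ω : EuclideanSpace ℝ (Fin (k + 1))) ^ 2
      ∂(volume : Measure (EuclideanSpace ℝ (Fin (k + 1)))).toSphere = 0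
  · have hzero : ∫ x in closedBall (0 : EuclideanSpace ℝ (Fin (k + 1))) (1 / 4), v x ^ 2 = 0 :=
      setIntegral_eq_zero_of_forall_eq_zero fun x hx => by
        rw [eq_zero_of_energy_le hv henergy h0
          (closedBall_subset_closedBall (by norm_num) hx), zero_pow two_ne_zero]
    rw [hzero]
    positivity
  · have hmono : ∫ x in closedBall (0 : EuclideanSpace ℝ (Fin (k + 1))) (1 / 4), v x ^ 2
        ≤ ∫ x in closedBall (0 : EuclideanSpace ℝ (Fin (k + 1))) 1, v x ^ 2 :=
      setIntegral_mono_set (integrableOn_closedBall_of_continuous (by fun_prop) _ _)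
        (Filter.Eventually.of_forall fun x => sq_nonneg _)
        (Filter.Eventually.of_forall (closedBall_subset_closedBall (by norm_num)))
    have hpoinc := setIntegral_closedBall_sq_le hk hv
    have hspec := integral_sq_le_sum_add_div hv hΦ horth' ⌈2 * L⌉₊
    have hK := henergy 1 one_pos le_rfl (by simpa using h0)
    simp only [one_smul] at hK
    set Hτ := ∫ ω, v (ω : EuclideanSpace ℝ (Fin (k + 1))) ^ 2
      ∂(volume : Measure (EuclideanSpace ℝ (Fin (k + 1)))).toSphere
    have hHτ0 : 0 ≤ Hτ := integral_nonneg fun ω => sq_nonneg _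
    set K := ∫ x in closedBall (0 : EuclideanSpace ℝ (Fin (k + 1))) 1, ∑ i, pd i v x ^ 2
    have hT : 2 * L ≤ ⌈2 * L⌉₊ + 1 := (Nat.le_ceil _).trans (by linarith)
    have hdiv : K / (⌈2 * L⌉₊ + 1) ≤ Hτ / 2 := by
      rw [div_le_iff₀ (by positivity)]
      have := mul_le_mul_of_nonneg_left hT hHτ0
      linarith
    have hHS : Hτ ≤ 2 * S := by linarith
    have := mul_le_mul_of_nonneg_left hHS (by positivity : 0 ≤ 1 + L)
    linarith
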